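/- arXiv:1704.06239 — 12 statements merged into one kernel-verified Lean document; each statement's English description precedes it below -/
import Mathlib

section
/- Let m ≥ 1, let x_1, …, x_m ∈ ℂ be distinct and closed under complex conjugation via a map σ, let b, c_1, …, c_m ∈ ℂ, and set q = b·η + ∑_{j=1}^m c_j·φ_j. Then all coefficients of q are real if and only if b is real (Im b = 0) and c_{σ(j)} = conj(c_j) for every j ∈ {1, …, m}. -/
open Polynomial Finset

/-- The polynomial `b·η + ∑ j, c j · φ j` attached to the nodes `x`. -/
noncomputable def nodalCombination {R ι : Type*} [CommRing R] [Fintype ι] [DecidableEq ι]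
    (x : ι → R) (b : R) (c : ι → R) : R[X] :=
  C b * (∏ j, (X - C (x j))) + ∑ j, C (c j) * ∏ k ∈ univ.erase j, (X - C (x k))

section nodalCombination

variable {R S ι : Type*} [CommRing R] [CommRing S] [Fintype ι] [DecidableEq ι]

theorem eval_nodalCombination_node (x : ι → R) (b : R) (c : ι → R) (i : ι) :
    (nodalCombination x b c).eval (x i) = c i * ∏ k ∈ univ.erase i, (x i - x k) := by
  have h_prod : ∏ j, (x i - x j) = 0 := prod_eq_zero (mem_univ i) (sub_self _)
  simp only [nodalCombination, eval_add, eval_mul, eval_C, eval_prod, eval_sub, eval_X,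
    eval_finsetSum, h_prod, mul_zero, zero_add]
  refine sum_eq_single i (fun j _ hj => ?_) (by simp)
  rw [prod_eq_zero (mem_erase.2 ⟨hj.symm, mem_univ i⟩) (sub_self _), mul_zero]

theorem nodalCombination_inj [IsDomain R] {x : ι → R} (hx : Function.Injective x)
    {b b' : R} {c c' : ι → R} :
    nodalCombination x b c = nodalCombination x b' c' ↔ b = b' ∧ c = c' := by
  refine ⟨fun h => ?_, fun h => by rw [h.1, h.2]⟩
  have hc : c = c' := by
    funext i
    have hi := congrArg (eval (x i)) h
    rw [eval_nodalCombination_node, eval_nodalCombination_node] at hi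
    refine mul_right_cancel₀ (prod_ne_zero_iff.2 fun k hk => ?_) hi
    exact sub_ne_zero.2 (hx.ne (ne_of_mem_erase hk).symm)
  subst hc
  refine ⟨?_, rfl⟩
  have h_eta : ∏ j, (X - C (x j)) ≠ 0 := prod_ne_zero_iff.2 fun j _ => X_sub_C_ne_zero _
  exact C_injective (mul_right_cancel₀ h_eta (add_right_cancel h))

theorem map_nodalCombination (f : R →+* S) (x : ι → R) (b : R) (c : ι → R) :
    (nodalCombination x b c).map f = nodalCombination (f ∘ x) (f b) (f ∘ c) := by
  simp [nodalCombination, Polynomial.map_sum, Polynomial.map_prod]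

theorem nodalCombination_comp_equiv (e : ι ≃ ι) (x : ι → R) (b : R) (c : ι → R) :
    nodalCombination (x ∘ e) b (c ∘ e) = nodalCombination x b c := by
  unfold nodalCombination
  congr 1
  · exact congrArg _ (Equiv.prod_comp e fun j => X - C (x j))
  · rw [← Equiv.sum_comp e fun j => C (c j) * _]
    refine sum_congr rfl fun j _ => congrArg _ ?_
    exact prod_equiv e (by simp) fun _ _ => rfl

end nodalCombination

theorem forall_coeff_im_eq_zero_iff_map_conj (p : ℂ[X]) :
    (∀ n, (p.coeff n).im = 0) ↔ p.map (starRingEnd ℂ) = p := by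
  simp [Polynomial.ext_iff, Complex.conj_eq_iff_im]

/-- Let `m ≥ 1`, let `x 1, …, x m ∈ ℂ` be distinct and closed under complex conjugation
via a map `σ` (i.e. `x (σ j) = conj (x j)`), and let
`q = b·η + ∑ j, c j · φ j` (with `η = ∏ j (X - x j)`, `φ j = ∏_{k ≠ j} (X - x k)`).
Then all coefficients of `q` are real iff `b` is real and `c (σ j) = conj (c j)` for all `j`. -/
theorem statement3 (m : ℕ) (hm : 1 ≤ m) (x : Fin m → ℂ) (hx : Function.Injective x)
    (σ : Fin m → Fin m) (hσ : ∀ j, x (σ j) = starRingEnd ℂ (x j))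
    (b : ℂ) (c : Fin m → ℂ) (q : Polynomial ℂ)
    (hq : q = C b * (∏ j, (X - C (x j))) +
        ∑ j, C (c j) * ∏ k ∈ univ.erase j, (X - C (x k))) :
    (∀ n, (q.coeff n).im = 0) ↔ (b.im = 0 ∧ ∀ j, c (σ j) = starRingEnd ℂ (c j)) := by
  have h_invol : Function.Involutive σ := fun j => hx (by rw [hσ, hσ, Complex.conj_conj])
  have h_conj : starRingEnd ℂ ∘ x = x ∘ h_invol.toPerm := funext fun j => (hσ j).symm
  replace hq : q = nodalCombination x b c := hq
  rw [forall_coeff_im_eq_zero_iff_map_conj, hq, map_nodalCombination, h_conj,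
    ← nodalCombination_comp_equiv h_invol.toPerm x b c,
    nodalCombination_inj (hx.comp h_invol.toPerm.injective), Complex.conj_eq_iff_im, funext_iff]
  exact and_congr_right fun _ => forall_congr' fun j => eq_comm
end

section
/- For a prescribed data set, the family of positive real rational interpolating functions is convex: let m ≥ 1, let x_1, …, x_m ∈ ℂ and y_1, …, y_m ∈ ℂ, and let (ν_1, d_1) and (ν_2, d_2) be positive real pairs of real polynomials such that for every j ∈ {1, …, m} and i ∈ {1, 2} one has d_i(x_j) ≠ 0 and ν_i(x_j)/d_i(x_j) = y_j. Then for every θ ∈ [0, 1] the pair (θ·ν_1·d_2 + (1 − θ)·ν_2·d_1, d_1·d_2), which represents the rational function θ·(ν_1/d_1) + (1 − θ)·(ν_2/d_2), is positive real and satisfies, for every j, (d_1·d_2)(x_j) ≠ 0 and (θ·ν_1·d_2 + (1 − θ)·ν_2·d_1)(x_j)/(d_1·d_2)(x_j) = y_j. -/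
open Polynomial

/-- A pair `(ν, d)` of real polynomials (with `d ≠ 0`) is positive real if for every
`s ∈ ℂ` with `Re s > 0` one has `d(s) ≠ 0` and `Re (ν(s)/d(s)) ≥ 0`. -/
def IsPosReal (ν d : Polynomial ℝ) : Prop :=
  d ≠ 0 ∧ ∀ s : ℂ, 0 < s.re →
    (Polynomial.aeval s) d ≠ 0 ∧ 0 ≤ ((Polynomial.aeval s) ν / (Polynomial.aeval s) d).re

/-- Away from the zeros of the denominators, the pair `(θ·ν₁·d₂ + (1-θ)·ν₂·d₁, d₁·d₂)`
represents the convex combination `θ·(ν₁/d₁) + (1-θ)·(ν₂/d₂)`. -/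
theorem aeval_convexComb_div {s : ℂ} {ν₁ d₁ ν₂ d₂ : Polynomial ℝ} (θ : ℝ)
    (h₁ : aeval s d₁ ≠ 0) (h₂ : aeval s d₂ ≠ 0) :
    aeval s (C θ * ν₁ * d₂ + C (1 - θ) * ν₂ * d₁) / aeval s (d₁ * d₂) =
      (θ : ℂ) * (aeval s ν₁ / aeval s d₁) +
        ((1 - θ : ℝ) : ℂ) * (aeval s ν₂ / aeval s d₂) := by
  simp only [map_add, map_mul, aeval_C, Complex.coe_algebraMap]
  field_simp

/-- For a prescribed data set, the family of positive real rational interpolating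
functions is convex: any convex combination `θ·(ν₁/d₁) + (1-θ)·(ν₂/d₂)`, represented by
the pair `(θ·ν₁·d₂ + (1-θ)·ν₂·d₁, d₁·d₂)`, of two positive real interpolants of the data
`(x j, y j)` is again a positive real interpolant of that data. -/
theorem statement7 (m : ℕ) (hm : 1 ≤ m) (x y : Fin m → ℂ)
    (ν₁ d₁ ν₂ d₂ : Polynomial ℝ)
    (h₁ : IsPosReal ν₁ d₁) (h₂ : IsPosReal ν₂ d₂)
    (hi₁ : ∀ j, (Polynomial.aeval (x j)) d₁ ≠ 0 ∧
      (Polynomial.aeval (x j)) ν₁ / (Polynomial.aeval (x j)) d₁ = y j)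
    (hi₂ : ∀ j, (Polynomial.aeval (x j)) d₂ ≠ 0 ∧
      (Polynomial.aeval (x j)) ν₂ / (Polynomial.aeval (x j)) d₂ = y j)
    (θ : ℝ) (hθ : θ ∈ Set.Icc (0 : ℝ) 1) :
    IsPosReal (C θ * ν₁ * d₂ + C (1 - θ) * ν₂ * d₁) (d₁ * d₂) ∧
      ∀ j, (Polynomial.aeval (x j)) (d₁ * d₂) ≠ 0 ∧
        (Polynomial.aeval (x j)) (C θ * ν₁ * d₂ + C (1 - θ) * ν₂ * d₁) /
          (Polynomial.aeval (x j)) (d₁ * d₂) = y j := by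
  refine ⟨⟨mul_ne_zero h₁.1 h₂.1, fun s hs => ?_⟩, fun j => ?_⟩
  · obtain ⟨hd₁, hp₁⟩ := h₁.2 s hs
    obtain ⟨hd₂, hp₂⟩ := h₂.2 s hs
    refine ⟨by simpa using ⟨hd₁, hd₂⟩, ?_⟩
    rw [aeval_convexComb_div θ hd₁ hd₂, Complex.add_re, Complex.re_ofReal_mul,
      Complex.re_ofReal_mul]
    exact add_nonneg (mul_nonneg hθ.1 hp₁) (mul_nonneg (sub_nonneg.2 hθ.2) hp₂)
  · obtain ⟨hd₁, hy₁⟩ := hi₁ j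
    obtain ⟨hd₂, hy₂⟩ := hi₂ j
    refine ⟨by simpa using ⟨hd₁, hd₂⟩, ?_⟩
    rw [aeval_convexComb_div θ hd₁ hd₂, hy₁, hy₂]
    push_cast
    ring
end

section
/- If a pair (ν, d) of real polynomials with ν ≠ 0 and d ≠ 0 is strictly positive real, then for every s ∈ ℂ with Re s ≥ 0 one has d(s) ≠ 0 and Re(ν(s)/d(s)) > 0; that is, a nonzero strictly positive real rational function has strictly positive real part on the whole closed right half plane. -/
open Polynomial

/-- A pair `(ν, d)` of real polynomials is strictly positive real if there exists `ε > 0`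
such that for every `s ∈ ℂ` with `Re s > -ε` one has `d(s) ≠ 0` and `Re (ν(s)/d(s)) ≥ 0`. -/
def IsStrictPosReal (ν d : Polynomial ℝ) : Prop :=
  ∃ ε > (0 : ℝ), ∀ s : ℂ, -ε < s.re →
    (Polynomial.aeval s) d ≠ 0 ∧ 0 ≤ ((Polynomial.aeval s) ν / (Polynomial.aeval s) d).re

/-- An analytic function with nonnegative real part on an open connected set, whose real part
vanishes at some point of the set, is constant there. -/
theorem eqOn_const_of_re_nonneg_of_re_eq_zero {U : Set ℂ} {f : ℂ → ℂ} {z : ℂ}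
    (hf : AnalyticOnNhd ℂ f U) (hU : IsOpen U) (hc : IsPreconnected U)
    (hre : ∀ w ∈ U, 0 ≤ (f w).re) (hz : z ∈ U) (h0 : (f z).re = 0) :
    ∃ c, ∀ w ∈ U, f w = c := by
  refine (hf.is_constant_or_isOpen hc).resolve_right fun hopen => ?_
  obtain ⟨r, hr, hball⟩ := Metric.isOpen_iff.1 (hopen U subset_rfl hU) (f z) ⟨z, hz, rfl⟩
  have hmem : f z - ((r / 2 : ℝ) : ℂ) ∈ Metric.ball (f z) r := by
    rw [Metric.mem_ball, dist_eq_norm, sub_sub_cancel_left, norm_neg, Complex.norm_real,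
      Real.norm_of_nonneg (by positivity)]
    linarith
  obtain ⟨w, hw, hwz⟩ := hball hmem
  have hw0 := hre w hw
  rw [hwz, Complex.sub_re, h0, Complex.ofReal_re] at hw0
  linarith

/-- A nonzero strictly positive real rational function has strictly positive real part on
the whole closed right half plane: if `(ν, d)` with `ν ≠ 0`, `d ≠ 0` is strictly
positive real, then `d(s) ≠ 0` and `Re (ν(s)/d(s)) > 0` whenever `Re s ≥ 0`. -/
theorem statement8 (ν d : Polynomial ℝ) (hν : ν ≠ 0) (hd : d ≠ 0)
    (h : IsStrictPosReal ν d) :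
    ∀ s : ℂ, 0 ≤ s.re →
      (Polynomial.aeval s) d ≠ 0 ∧ 0 < ((Polynomial.aeval s) ν / (Polynomial.aeval s) d).re := by
  obtain ⟨ε, hε, h⟩ := h
  intro s hs
  have hs' : -ε < s.re := by linarith
  refine ⟨(h s hs').1, (h s hs').2.lt_of_ne' fun h0 => hν ?_⟩
  have han (p : Polynomial ℝ) : AnalyticOnNhd ℂ (fun z : ℂ => aeval z p) {z | -ε < z.re} :=
    AnalyticOnNhd.aeval_polynomial analyticOnNhd_id p
  obtain ⟨c, hc⟩ := eqOn_const_of_re_nonneg_of_re_eq_zero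
    ((han ν).div (han d) fun z hz => (h z hz).1)
    (isOpen_lt continuous_const Complex.continuous_re)
    (convex_halfSpace_re_gt (-ε)).isPreconnected (fun z hz => (h z hz).2) hs' h0
  have hc0 : c.re = 0 := (congrArg Complex.re (hc s hs')).symm.trans h0
  refine Polynomial.eq_zero_of_infinite_isRoot ν ((Set.Ioi_infinite (-ε)).mono fun x hx => ?_)
  have hx' : -ε < (x : ℂ).re := hx
  have hreal (p : Polynomial ℝ) : aeval (x : ℂ) p = ((p.eval x : ℝ) : ℂ) :=
    aeval_algebraMap_apply_eq_algebraMap_eval x p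
  have hq : ν.eval x / d.eval x = 0 := by
    have hcx := congrArg Complex.re (hc x hx')
    simpa only [Pi.div_apply, hreal, ← Complex.ofReal_div, Complex.ofReal_re, hc0] using hcx
  have hdx := (h x hx').1
  rw [hreal, Complex.ofReal_ne_zero] at hdx
  exact (div_eq_zero_iff.1 hq).resolve_right hdx
end

section
/- The inverse of a nonzero positive real rational function is positive real: if (ν, d) is a positive real pair of real polynomials with ν ≠ 0, then for every s ∈ ℂ with Re s > 0 one has ν(s) ≠ 0 and Re(d(s)/ν(s)) ≥ 0; in other words, the pair (d, ν) is positive real. -/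
open Polynomial

/-- An analytic function with nonnegative real part on an open preconnected set that vanishes
at a point of this set is identically zero on it. -/
theorem AnalyticOnNhd.eqOn_zero_of_re_nonneg {f : ℂ → ℂ} {U : Set ℂ} {z : ℂ}
    (hf : AnalyticOnNhd ℂ f U) (hUo : IsOpen U) (hU : IsPreconnected U)
    (hre : ∀ w ∈ U, 0 ≤ (f w).re) (hz : z ∈ U) (hfz : f z = 0) : Set.EqOn f 0 U := by
  rcases hf.is_constant_or_isOpen hU with ⟨c, hc⟩ | hopen
  · intro w hw
    rw [hc w hw, ← hc z hz, hfz, Pi.zero_apply]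
  · obtain ⟨ε, hε, hball⟩ :=
      Metric.isOpen_iff.1 (hopen U subset_rfl hUo) 0 ⟨z, hz, hfz⟩
    have hmem : ((-(ε / 2) : ℝ) : ℂ) ∈ Metric.ball (0 : ℂ) ε := by
      rw [mem_ball_zero_iff, Complex.norm_real, norm_neg, Real.norm_of_nonneg (by positivity)]
      exact half_lt_self hε
    obtain ⟨w, hw, hfw⟩ := hball hmem
    have h := hre w hw
    rw [hfw, Complex.ofReal_re] at h
    linarith

/-- The inverse of a complex number with nonnegative real part has nonnegative real part. -/
theorem Complex.inv_re_nonneg {z : ℂ} (hz : 0 ≤ z.re) : 0 ≤ (z⁻¹).re := by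
  rw [Complex.inv_re]
  exact div_nonneg hz (Complex.normSq_nonneg z)

/-- The numerator of a nonzero positive real function has no zero in the open right half
plane. -/
theorem IsPosReal.aeval_num_ne_zero {ν d : Polynomial ℝ} (h : IsPosReal ν d) (hν : ν ≠ 0)
    {s : ℂ} (hs : 0 < s.re) : aeval s ν ≠ 0 := by
  intro hzero
  have hf : AnalyticOnNhd ℂ (fun w : ℂ => aeval w ν / aeval w d) {w | 0 < w.re} :=
    fun w hw => ((AnalyticOnNhd.aeval_polynomial (𝕜 := ℂ) analyticOnNhd_id ν) w hw).div
      ((AnalyticOnNhd.aeval_polynomial (𝕜 := ℂ) analyticOnNhd_id d) w hw) (h.2 w hw).1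
  have hEq := hf.eqOn_zero_of_re_nonneg (isOpen_lt continuous_const Complex.continuous_re)
    (convex_halfSpace_re_gt 0).isPreconnected (fun w hw => (h.2 w hw).2) hs (by simp [hzero])
  refine hν (ν.eq_zero_of_infinite_isRoot ((Set.Ioi_infinite (0 : ℝ)).mono fun x hx => ?_))
  have hx' : (x : ℂ) ∈ {w : ℂ | 0 < w.re} := by simpa using hx
  have hνx : aeval (x : ℂ) ν = 0 := (div_eq_zero_iff.1 (hEq hx')).resolve_right (h.2 x hx').1
  have hcast : aeval (x : ℂ) ν = ((ν.eval x : ℝ) : ℂ) :=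
    aeval_algebraMap_apply_eq_algebraMap_eval x ν
  rw [hcast] at hνx
  exact Complex.ofReal_eq_zero.1 hνx

/-- The inverse of a nonzero positive real rational function is positive real: if
`(ν, d)` is positive real and `ν ≠ 0`, then `ν(s) ≠ 0` and `Re (d(s)/ν(s)) ≥ 0` for
every `s` in the open right half plane, i.e. the pair `(d, ν)` is positive real. -/
theorem statement9 (ν d : Polynomial ℝ) (h : IsPosReal ν d) (hν : ν ≠ 0) :
    IsPosReal d ν := by
  refine ⟨hν, fun s hs => ⟨h.aeval_num_ne_zero hν hs, ?_⟩⟩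
  rw [← inv_div]
  exact Complex.inv_re_nonneg (h.2 s hs).2
end

section
/- Let x ∈ ℂ with Re x < 0 and let c ∈ ℂ satisfy Re(c)·(−Re x) > |Im(c)·Im(x)|. Then the rational function s ↦ c/(s − x) + conj(c)/(s − conj(x)) is strictly positive real: there exists ε > 0 such that for every s ∈ ℂ with Re s > −ε one has s ≠ x, s ≠ conj(x), and Re( c/(s − x) + conj(c)/(s − conj(x)) ) ≥ 0. -/
/-- Two conjugate first-order terms, written in the real coordinates `a + b * I` of the residue,
have nonnegative sum of real parts as soon as `|b * q| ≤ a * u`. -/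
theorem div_add_div_nonneg_of_abs_mul_le {a b u w q : ℝ} (hu : 0 < u) (h : |b * q| ≤ a * u) :
    0 ≤ (a * u + b * (w - q)) / (u ^ 2 + (w - q) ^ 2) +
      (a * u - b * (w + q)) / (u ^ 2 + (w + q) ^ 2) := by
  obtain ⟨h₁, h₂⟩ := abs_le.mp h
  have hd₁ : 0 < u ^ 2 + (w - q) ^ 2 := by positivity
  have hd₂ : 0 < u ^ 2 + (w + q) ^ 2 := by positivity
  rw [div_add_div _ _ hd₁.ne' hd₂.ne']
  refine div_nonneg ?_ (by positivity)
  have hm : 0 ≤ (a * u - b * q) * (u ^ 2 + q ^ 2) :=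
    mul_nonneg (by linarith) (by positivity)
  have hp : 0 ≤ (a * u + b * q) * w ^ 2 := mul_nonneg (by linarith) (by positivity)
  linear_combination 2 * hm + 2 * hp

/-- Let `x ∈ ℂ` with `Re x < 0` and let `c ∈ ℂ` satisfy
`Re c · (-Re x) > |Im c · Im x|`.  Then the function
`s ↦ c/(s - x) + conj c/(s - conj x)` is strictly positive real: there is `ε > 0` such
that for every `s` with `Re s > -ε` the function is defined (`s ≠ x`, `s ≠ conj x`) and
has nonnegative real part. -/
theorem statement10 (x c : ℂ) (hx : x.re < 0)
    (hc : |c.im * x.im| < c.re * (-x.re)) :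
    ∃ ε > (0 : ℝ), ∀ s : ℂ, -ε < s.re →
      s ≠ x ∧ s ≠ starRingEnd ℂ x ∧
      0 ≤ (c / (s - x) + starRingEnd ℂ c / (s - starRingEnd ℂ x)).re := by
  have ha : 0 < c.re := pos_of_mul_pos_left ((abs_nonneg _).trans_lt hc) (by linarith)
  refine ⟨-x.re - |c.im * x.im| / c.re, ?_, fun s hs => ?_⟩
  · rw [gt_iff_lt, sub_pos, div_lt_iff₀ ha]
    linarith
  have hus : |c.im * x.im| / c.re < s.re - x.re := by linarith
  have hu : 0 < s.re - x.re := lt_of_le_of_lt (by positivity) hus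
  have hle : |c.im * x.im| ≤ c.re * (s.re - x.re) := by
    rw [div_lt_iff₀ ha] at hus
    linarith
  refine ⟨?_, ?_, ?_⟩
  · rintro rfl
    simp at hu
  · rintro rfl
    simp at hu
  · convert div_add_div_nonneg_of_abs_mul_le (w := s.im) hu hle using 1
    simp only [Complex.add_re, Complex.div_re, Complex.normSq_apply, Complex.sub_re,
      Complex.sub_im, Complex.conj_re, Complex.conj_im]
    ring
end

section
/- Let m ≥ 1 and let x_1, …, x_m ∈ ℂ be distinct with Re x_j < 0 for all j, closed under complex conjugation. Then there exist nonzero c_1, …, c_m ∈ ℂ such that the polynomial d_1 = η + ∑_{j=1}^m c_j·φ_j has all real coefficients, has degree m, and the pair (η, d_1) (i.e. the rational function Δ_1 = η/d_1 = (1 + ∑_{j=1}^m c_j/(s − x_j))^{-1}) is strictly positive real. -/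
open Polynomial Finset

/-- A pair `(ν, d)` of complex polynomials is strictly positive real if there exists
`ε > 0` such that for every `s ∈ ℂ` with `Re s > -ε` one has `d(s) ≠ 0` and
`Re (ν(s)/d(s)) ≥ 0`. -/
def IsStrictPosRealC (ν d : Polynomial ℂ) : Prop :=
  ∃ ε > (0 : ℝ), ∀ s : ℂ, -ε < s.re →
    d.eval s ≠ 0 ∧ 0 ≤ (ν.eval s / d.eval s).re

/-- A complex polynomial fixed by coefficientwise conjugation has real coefficients. -/
theorem coeff_im_eq_zero_of_map_conj_eq {p : Polynomial ℂ}
    (hp : p.map (starRingEnd ℂ) = p) (n : ℕ) : (p.coeff n).im = 0 := by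
  rw [← Complex.conj_eq_iff_im, ← coeff_map, hp]

/-- The nodal polynomial of distinct nodes closed under conjugation is fixed by conjugation. -/
theorem map_conj_prod_X_sub_C {ι : Type*} [Fintype ι] {x : ι → ℂ}
    (hx : Function.Injective x) {σ : ι → ι} (hσ : ∀ j, x (σ j) = starRingEnd ℂ (x j)) :
    (∏ j, (X - C (x j))).map (starRingEnd ℂ) = ∏ j, (X - C (x j)) := by
  have hinj : Function.Injective σ := fun a b hab =>
    hx ((starRingEnd ℂ).injective (by rw [← hσ, ← hσ, hab]))
  simp only [Polynomial.map_prod, Polynomial.map_sub, map_X, map_C, ← hσ]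
  exact (Finite.injective_iff_bijective.mp hinj).prod_comp fun j => X - C (x j)

theorem derivative_prod_X_sub_C {R ι : Type*} [CommRing R] [DecidableEq ι] (s : Finset ι)
    (x : ι → R) :
    derivative (∏ j ∈ s, (X - C (x j))) = ∑ j ∈ s, ∏ k ∈ s.erase j, (X - C (x k)) := by
  simp [Polynomial.derivative_prod_finset]

theorem eval_prod_add_derivative {K ι : Type*} [Field K] (s : Finset ι) (x : ι → K) (z : K)
    (hz : ∀ j ∈ s, z - x j ≠ 0) :
    (∏ j ∈ s, (X - C (x j)) + derivative (∏ j ∈ s, (X - C (x j)))).eval z =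
      (∏ j ∈ s, (X - C (x j))).eval z * (1 + ∑ j ∈ s, (z - x j)⁻¹) := by
  classical
  rw [derivative_prod_X_sub_C, eval_add, eval_finsetSum, mul_add, mul_one, mul_sum]
  congr 1
  refine sum_congr rfl fun j hj => ?_
  rw [← mul_prod_erase s _ hj, eval_mul]
  simp only [eval_sub, eval_X, eval_C]
  field_simp [hz j hj]

theorem isStrictPosRealC_prod_add_derivative {ι : Type*} [Fintype ι] (x : ι → ℂ)
    (hre : ∀ j, (x j).re < 0) :
    IsStrictPosRealC (∏ j, (X - C (x j)))
      (∏ j, (X - C (x j)) + derivative (∏ j, (X - C (x j)))) := by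
  obtain ⟨ε, hε, hεx⟩ : ∃ ε > (0 : ℝ), ∀ j, ε ≤ -(x j).re := by
    rcases isEmpty_or_nonempty ι with h | h
    · exact ⟨1, one_pos, fun j => h.elim j⟩
    · obtain ⟨i, hi⟩ := Finite.exists_min fun j => -(x j).re
      exact ⟨_, neg_pos.mpr (hre i), hi⟩
  refine ⟨ε, hε, fun z hz => ?_⟩
  have hpos : ∀ j, 0 < (z - x j).re := fun j => by
    rw [Complex.sub_re]
    linarith [hεx j]
  have hne : ∀ j, z - x j ≠ 0 := fun j h => by simpa [h] using hpos j
  have hη : (∏ j, (X - C (x j))).eval z ≠ 0 := by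
    simpa [eval_prod, prod_eq_zero_iff] using hne
  have hfac : 0 < (1 + ∑ j, (z - x j)⁻¹).re := by
    rw [Complex.add_re, Complex.one_re, Complex.re_sum]
    have : 0 ≤ ∑ j, ((z - x j)⁻¹).re := sum_nonneg fun j _ => by
      rw [Complex.inv_re]
      exact div_nonneg (hpos j).le (Complex.normSq_nonneg _)
    linarith
  rw [eval_prod_add_derivative _ _ _ fun j _ => hne j]
  refine ⟨mul_ne_zero hη fun h => by simp [h] at hfac, ?_⟩
  rw [div_mul_cancel_left₀ hη, Complex.inv_re]
  exact div_nonneg hfac.le (Complex.normSq_nonneg _)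

/-- Let `m ≥ 1` and let `x 1, …, x m ∈ ℂ` be distinct, in the open left half plane, and
closed under complex conjugation.  Then there exist nonzero `c 1, …, c m ∈ ℂ` such that
`d₁ = η + ∑ j, c j · φ j` (with `η = ∏ j (X - x j)`, `φ j = ∏_{k ≠ j} (X - x k)`) has all
real coefficients, has degree `m`, and the pair `(η, d₁)`, i.e. the rational function
`Δ₁ = η/d₁ = (1 + ∑ j, c j/(s - x j))⁻¹`, is strictly positive real. -/
theorem statement11 (m : ℕ) (hm : 1 ≤ m) (x : Fin m → ℂ) (hx : Function.Injective x)
    (hre : ∀ j, (x j).re < 0)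
    (σ : Fin m → Fin m) (hσ : ∀ j, x (σ j) = starRingEnd ℂ (x j)) :
    ∃ c : Fin m → ℂ, ∃ d₁ : Polynomial ℂ,
      d₁ = (∏ j, (X - C (x j))) + ∑ j, C (c j) * ∏ k ∈ univ.erase j, (X - C (x k)) ∧
      (∀ j, c j ≠ 0) ∧
      (∀ n, (d₁.coeff n).im = 0) ∧
      d₁.degree = (m : ℕ) ∧
      IsStrictPosRealC (∏ j, (X - C (x j))) d₁ := by
  refine ⟨fun _ => 1, ∏ j, (X - C (x j)) + derivative (∏ j, (X - C (x j))), ?_,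
    fun _ => one_ne_zero, coeff_im_eq_zero_of_map_conj_eq ?_, ?_,
    isStrictPosRealC_prod_add_derivative x hre⟩
  · simp [derivative_prod_X_sub_C]
  · rw [Polynomial.map_add, ← derivative_map, map_conj_prod_X_sub_C hx hσ]
  · have hmonic : (∏ j, (X - C (x j))).Monic := monic_prod_X_sub_C x univ
    rw [degree_add_eq_left_of_degree_lt (degree_derivative_lt hmonic.ne_zero)]
    simp [degree_prod]
end

section
/- Let m ≥ 1 and let x_1, …, x_m ∈ ℂ be distinct with Re x_j < 0 for all j, closed under complex conjugation. Then there exist nonzero γ_1, …, γ_m ∈ ℂ with ∑_{j=1}^m γ_j = 1 such that the polynomial d_o = ∑_{j=1}^m γ_j·φ_j has all real coefficients, has degree m − 1, and the pair (η, d_o) (i.e. the rational function Δ_o = η/d_o = (∑_{j=1}^m γ_j/(s − x_j))^{-1}) is strictly positive real. -/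
open Polynomial Finset

/-- The product of the linear factors of a conjugation-closed family has real coefficients. -/
lemma im_coeff_prod_X_sub_C_eq_zero {ι : Type*} [Fintype ι] {x : ι → ℂ}
    (hx : Function.Injective x) {σ : ι → ι} (hσ : ∀ j, x (σ j) = starRingEnd ℂ (x j)) (n : ℕ) :
    ((∏ j, (X - C (x j))).coeff n).im = 0 := by
  have hinj : Function.Injective σ := fun i j h => hx <| by
    apply (starRingEnd ℂ).injective
    rw [← hσ, ← hσ, h]
  have hmap : (∏ j, (X - C (x j))).map (starRingEnd ℂ) = ∏ j, (X - C (x j)) := by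
    rw [Polynomial.map_prod, ← (Finite.injective_iff_bijective.mp hinj).prod_comp]
    simp [hσ]
  rw [← Complex.conj_eq_iff_im, ← coeff_map, hmap]

/-- If `s` lies strictly to the right of all the `x j`, then the logarithmic derivative of
`∏ j, (X - C (x j))` has positive real part at `s`. -/
lemma re_sum_inv_sub_pos {ι : Type*} [Fintype ι] [Nonempty ι] {x : ι → ℂ} {s : ℂ}
    (h : ∀ j, (x j).re < s.re) : 0 < (∑ j, (s - x j)⁻¹).re := by
  rw [Complex.re_sum]
  refine sum_pos (fun j _ => ?_) univ_nonempty
  have hre : 0 < (s - x j).re := by simpa using h j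
  rw [Complex.inv_re]
  exact div_pos hre (Complex.normSq_pos.mpr fun h0 => by simp [h0] at hre)

lemma eval_derivative_prod_X_sub_C {ι : Type*} [Fintype ι] {x : ι → ℂ} {s : ℂ}
    (h : ∀ j, s ≠ x j) :
    (derivative (∏ j, (X - C (x j)))).eval s =
      (∏ j, (X - C (x j))).eval s * ∑ j, (s - x j)⁻¹ := by
  classical
  rw [derivative_prod_finset, eval_finsetSum, mul_sum]
  refine sum_congr rfl fun j _ => ?_
  rw [← mul_prod_erase univ _ (mem_univ j)]
  have := sub_ne_zero.mpr (h j)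
  simp
  field_simp

lemma isStrictPosRealC_prod_X_sub_C_derivative {ι : Type*} [Fintype ι] [Nonempty ι] {x : ι → ℂ}
    (hre : ∀ j, (x j).re < 0) {c : ℝ} (hc : 0 < c) :
    IsStrictPosRealC (∏ j, (X - C (x j))) (C (c : ℂ) * derivative (∏ j, (X - C (x j)))) := by
  obtain ⟨i, hi⟩ := Finite.exists_max fun j => (x j).re
  refine ⟨-(x i).re, neg_pos.mpr (hre i), fun s hs => ?_⟩
  rw [neg_neg] at hs
  have hlt : ∀ j, (x j).re < s.re := fun j => (hi j).trans_lt hs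
  have hne : ∀ j, s ≠ x j := fun j h => (hlt j).ne (by rw [h])
  have hη : (∏ j, (X - C (x j))).eval s ≠ 0 := by
    simpa [eval_prod, prod_ne_zero_iff, sub_ne_zero] using hne
  have hpos := re_sum_inv_sub_pos hlt
  have hc' : (c : ℂ) ≠ 0 := by exact_mod_cast hc.ne'
  have hH : ∑ j, (s - x j)⁻¹ ≠ 0 := fun h0 => by simp [h0] at hpos
  rw [eval_mul, eval_C, eval_derivative_prod_X_sub_C hne]
  refine ⟨mul_ne_zero hc' (mul_ne_zero hη hH), ?_⟩
  rw [mul_left_comm, div_mul_cancel_left₀ hη, Complex.inv_re, Complex.re_ofReal_mul]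
  exact div_nonneg (mul_nonneg hc.le hpos.le) (Complex.normSq_nonneg _)

/-- Let `m ≥ 1` and let `x 1, …, x m ∈ ℂ` be distinct, in the open left half plane, and
closed under complex conjugation.  Then there exist nonzero `γ 1, …, γ m ∈ ℂ` summing to
`1` such that `d_o = ∑ j, γ j · φ j` (with `φ j = ∏_{k ≠ j} (X - x k)`) has all real
coefficients, has degree `m - 1`, and the pair `(η, d_o)`, i.e. the rational function
`Δ_o = η/d_o = (∑ j, γ j/(s - x j))⁻¹`, is strictly positive real. -/
theorem statement12 (m : ℕ) (hm : 1 ≤ m) (x : Fin m → ℂ) (hx : Function.Injective x)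
    (hre : ∀ j, (x j).re < 0)
    (σ : Fin m → Fin m) (hσ : ∀ j, x (σ j) = starRingEnd ℂ (x j)) :
    ∃ γ : Fin m → ℂ, ∃ d_o : Polynomial ℂ,
      d_o = ∑ j, C (γ j) * ∏ k ∈ univ.erase j, (X - C (x k)) ∧
      (∀ j, γ j ≠ 0) ∧
      (∑ j, γ j) = 1 ∧
      (∀ n, (d_o.coeff n).im = 0) ∧
      d_o.degree = ((m - 1 : ℕ) : WithBot ℕ) ∧
      IsStrictPosRealC (∏ j, (X - C (x j))) d_o := by
  have : NeZero m := ⟨by omega⟩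
  have hm0 : (m : ℂ) ≠ 0 := NeZero.ne _
  have hd : ∑ j, C ((m : ℂ)⁻¹) * ∏ k ∈ univ.erase j, (X - C (x k)) =
      C (((m : ℝ)⁻¹ : ℝ) : ℂ) * derivative (∏ j, (X - C (x j))) := by
    rw [derivative_prod_finset, mul_sum]
    simp
  refine ⟨fun _ => (m : ℂ)⁻¹, _, rfl, fun _ => inv_ne_zero hm0, by simp [hm0], ?_⟩
  rw [hd]
  refine ⟨fun n => ?_, ?_, isStrictPosRealC_prod_X_sub_C_derivative hre (by positivity)⟩
  · rw [coeff_C_mul, coeff_derivative, Complex.im_ofReal_mul]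
    simp [Complex.mul_im, im_coeff_prod_X_sub_C_eq_zero hx hσ]
  · have hdeg : (∏ j, (X - C (x j))).natDegree = m := by simp
    rw [degree_C_mul (by simpa using hm0), degree_derivative (by omega), hdeg]
end

section
/- The set of admissible coefficients is positively unbounded: let m ≥ 1, let x_1, …, x_m ∈ ℂ be distinct with Re x_j < 0 for all j, closed under complex conjugation via σ, and let c_1, …, c_m ∈ ℂ be such that d_1 = η + ∑_{j=1}^m c_j·φ_j has all real coefficients and the pair (η, d_1) is strictly positive real. If δ_1, …, δ_m are nonnegative real numbers with δ_{σ(j)} = δ_j for all j, then the polynomial d_1' = η + ∑_{j=1}^m (c_j + δ_j)·φ_j has all real coefficients and the pair (η, d_1') is strictly positive real. -/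
open Polynomial Finset

/-- A weighted sum of the products `∏ k ≠ j, (X - x k)` has real coefficients when the nodes and
the real weights are invariant under conjugation. -/
theorem im_coeff_sum_mul_prod_erase {ι : Type*} [Fintype ι] [DecidableEq ι] {x : ι → ℂ}
    (hx : Function.Injective x) {σ : ι → ι} (hσ : ∀ j, x (σ j) = starRingEnd ℂ (x j))
    {δ : ι → ℝ} (hδσ : ∀ j, δ (σ j) = δ j) (n : ℕ) :
    ((∑ j, C (δ j : ℂ) * ∏ k ∈ univ.erase j, (X - C (x k))).coeff n).im = 0 := by
  have hinj : Function.Injective σ := fun a b h =>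
    hx ((starRingEnd ℂ).injective (by rw [← hσ, ← hσ, h]))
  have hbij : Function.Bijective σ := Finite.injective_iff_bijective.mp hinj
  have hmap : (∑ j, C (δ j : ℂ) * ∏ k ∈ univ.erase j, (X - C (x k))).map (starRingEnd ℂ) =
      ∑ j, C (δ j : ℂ) * ∏ k ∈ univ.erase j, (X - C (x k)) := by
    simp only [Polynomial.map_sum, Polynomial.map_mul, Polynomial.map_prod, Polynomial.map_sub,
      map_X, map_C, Complex.conj_ofReal, ← hσ]
    refine Fintype.sum_bijective σ hbij _ _ fun j => ?_
    rw [hδσ]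
    congr 1
    rw [← Finset.prod_image (s := univ.erase j) (g := σ) (f := fun k => X - C (x k))
      hinj.injOn, Finset.image_erase hinj, Finset.image_univ_of_surjective hbij.surjective]
  rw [← Complex.conj_eq_iff_im, ← coeff_map, hmap]

/-- Partial fraction expansion of `(η + ∑ j, a j * φ j) / η` away from the nodes. -/
theorem eval_add_sum_mul_prod_erase {ι : Type*} [Fintype ι] [DecidableEq ι] (x a : ι → ℂ)
    {s : ℂ} (hs : ∀ j, s - x j ≠ 0) :
    ((∏ j, (X - C (x j))) + ∑ j, C (a j) * ∏ k ∈ univ.erase j, (X - C (x k))).eval s =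
      (∏ j, (X - C (x j))).eval s * (1 + ∑ j, a j / (s - x j)) := by
  simp only [eval_add, eval_finsetSum, eval_mul, eval_C, eval_prod, eval_sub, eval_X]
  rw [mul_add, mul_one, Finset.mul_sum]
  congr 1
  refine Finset.sum_congr rfl fun j _ => ?_
  rw [← Finset.mul_prod_erase univ (fun k => s - x k) (Finset.mem_univ j)]
  field_simp [hs j]

theorem inv_re_nonneg_iff {z : ℂ} : 0 ≤ z⁻¹.re ↔ 0 ≤ z.re := by
  rcases eq_or_ne z 0 with rfl | hz
  · simp
  · rw [Complex.inv_re, le_div_iff₀ (Complex.normSq_pos.mpr hz), zero_mul]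

theorem ofReal_div_re_pos {a : ℝ} {z : ℂ} (ha : 0 < a) (hz : 0 < z.re) :
    0 < ((a : ℂ) / z).re := by
  have hz0 : z ≠ 0 := by rintro rfl; simp at hz
  rw [div_eq_mul_inv, Complex.re_ofReal_mul, Complex.inv_re]
  exact mul_pos ha (div_pos hz (Complex.normSq_pos.mpr hz0))

/-- The set of admissible coefficients is positively unbounded: for distinct nodes
`x 1, …, x m` in the open left half plane, closed under conjugation via `σ`, if
`d₁ = η + ∑ j, c j · φ j` has real coefficients and `(η, d₁)` is strictly positive real,
then for any nonnegative reals `δ j` with `δ (σ j) = δ j`, the polynomial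
`d₁' = η + ∑ j, (c j + δ j) · φ j` also has real coefficients and `(η, d₁')` is strictly
positive real. -/
theorem statement13 (m : ℕ) (hm : 1 ≤ m) (x : Fin m → ℂ) (hx : Function.Injective x)
    (hre : ∀ j, (x j).re < 0)
    (σ : Fin m → Fin m) (hσ : ∀ j, x (σ j) = starRingEnd ℂ (x j))
    (c : Fin m → ℂ)
    (hreal : ∀ n, ((((∏ j, (X - C (x j))) +
        ∑ j, C (c j) * ∏ k ∈ univ.erase j, (X - C (x k)))).coeff n).im = 0)
    (hspr : IsStrictPosRealC (∏ j, (X - C (x j)))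
      ((∏ j, (X - C (x j))) + ∑ j, C (c j) * ∏ k ∈ univ.erase j, (X - C (x k))))
    (δ : Fin m → ℝ) (hδ : ∀ j, 0 ≤ δ j) (hδσ : ∀ j, δ (σ j) = δ j) :
    (∀ n, ((((∏ j, (X - C (x j))) +
        ∑ j, C (c j + (δ j : ℂ)) * ∏ k ∈ univ.erase j, (X - C (x k)))).coeff n).im = 0) ∧
    IsStrictPosRealC (∏ j, (X - C (x j)))
      ((∏ j, (X - C (x j))) + ∑ j, C (c j + (δ j : ℂ)) * ∏ k ∈ univ.erase j, (X - C (x k))) := by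
  constructor
  · intro n
    have h := im_coeff_sum_mul_prod_erase hx hσ hδσ n
    have h' := hreal n
    simp only [C_add, add_mul, Finset.sum_add_distrib, ← add_assoc]
    rw [coeff_add, Complex.add_im, h', h, add_zero]
  · by_cases h0 : ∀ j, δ j = 0
    · simpa [h0] using hspr
    push Not at h0
    obtain ⟨j₀, hj₀⟩ := h0
    obtain ⟨ε, hε, H⟩ := hspr
    have : Nonempty (Fin m) := ⟨j₀⟩
    obtain ⟨i, hi⟩ := Finite.exists_max fun j => (x j).re
    refine ⟨min ε (-(x i).re), lt_min hε (neg_pos.mpr (hre i)), fun s hs => ?_⟩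
    have hsε : -ε < s.re := by linarith [min_le_left ε (-(x i).re)]
    have hpos : ∀ j, 0 < (s - x j).re := fun j => by
      rw [Complex.sub_re]
      linarith [min_le_right ε (-(x i).re), hi j]
    have hne : ∀ j, s - x j ≠ 0 := fun j h => by simpa [h] using hpos j
    have hη : (∏ j, (X - C (x j))).eval s ≠ 0 := by
      simpa [eval_prod, Finset.prod_ne_zero_iff] using hne
    obtain ⟨-, hd⟩ := H s hsε
    rw [eval_add_sum_mul_prod_erase x c hne, div_mul_cancel_left₀ hη, inv_re_nonneg_iff] at hd
    have hδpos : 0 < (∑ j, (δ j : ℂ) / (s - x j)).re := by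
      rw [Complex.re_sum]
      refine Finset.sum_pos' (fun j _ => ?_)
        ⟨j₀, Finset.mem_univ _, ofReal_div_re_pos ((hδ j₀).lt_of_ne' hj₀) (hpos j₀)⟩
      rcases (hδ j).eq_or_lt with h | h
      · simp [← h]
      · exact (ofReal_div_re_pos h (hpos j)).le
    have hd' : 0 < (1 + ∑ j, (c j + (δ j : ℂ)) / (s - x j)).re := by
      simp only [add_div, Finset.sum_add_distrib, ← add_assoc]
      rw [Complex.add_re]
      exact add_pos_of_nonneg_of_pos hd hδpos
    rw [eval_add_sum_mul_prod_erase x (fun j => c j + (δ j : ℂ)) hne]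
    refine ⟨mul_ne_zero hη fun h => by simp [h] at hd', ?_⟩
    rw [div_mul_cancel_left₀ hη, inv_re_nonneg_iff]
    exact hd'.le
end

section
/- Let m ≥ 1, let x_1, …, x_m ∈ ℂ be distinct with Re x_j < 0 for all j and closed under complex conjugation, and let d ∈ ℝ[X] with degree at most m be such that the pair (η, d) is strictly positive real. Then there exists δ > 0 such that for every s ∈ ℂ with Re s > 0 one has Re(η(s)/d(s)) ≥ δ; that is, the real part of Δ = η/d is bounded away from zero on the open right half plane. -/
open Polynomial Finset

open Filter Topology Bornology in
/-- A quotient of polynomials with numerator and denominator of degree at most `n` tends at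
infinity to the quotient of the coefficients of degree `n`. -/
theorem tendsto_aeval_div_aeval_cobounded {p q : ℝ[X]} {n : ℕ} (hp : p.natDegree ≤ n)
    (hq : q.natDegree ≤ n) (hn : q.coeff n ≠ 0) :
    Tendsto (fun s : ℂ => aeval s p / aeval s q) (cobounded ℂ)
      (𝓝 ((p.coeff n / q.coeff n : ℝ) : ℂ)) := by
  have key : ∀ r : ℝ[X],
      Tendsto (fun s : ℂ => aeval s⁻¹ (reflect n r)) (cobounded ℂ) (𝓝 (r.coeff n : ℂ)) := by
    intro r
    have h0 : aeval (0 : ℂ) (reflect n r) = (r.coeff n : ℂ) := by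
      rw [← coeff_zero_eq_aeval_zero', coeff_reflect, revAt_le (Nat.zero_le n)]
      simp
    rw [← h0]
    exact ((reflect n r).continuous_aeval.tendsto 0).comp tendsto_inv₀_cobounded
  have hlim := (key p).div (key q) (by exact_mod_cast hn)
  rw [Complex.ofReal_div]
  refine hlim.congr' ?_
  filter_upwards [eventually_ne_cobounded (0 : ℂ)] with s hs
  have heval : ∀ r : ℝ[X], r.natDegree ≤ n →
      aeval s r = aeval s⁻¹ (reflect n r) * s ^ n := by
    intro r hr
    let := invertibleOfNonzero hs
    have h := eval₂_reflect_mul_pow (algebraMap ℝ ℂ) s n r hr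
    rw [invOf_eq_inv] at h
    simpa only [aeval_def] using h.symm
  rw [heval p hp, heval q hq, Pi.div_apply, mul_div_mul_right _ _ (pow_ne_zero n hs)]

open Filter Topology Bornology in
/-- If `f s / s ^ k` has limit `a` at infinity and `f` has nonnegative real part on the closed
right half plane, then `a * u ^ k` has nonnegative real part for all `u` in that half plane. -/
theorem re_mul_pow_nonneg_of_tendsto_div_pow {f : ℂ → ℂ} {k : ℕ} {a u : ℂ}
    (hf : ∀ s : ℂ, 0 ≤ s.re → 0 ≤ (f s).re)
    (h : Tendsto (fun s => f s / s ^ k) (cobounded ℂ) (𝓝 a)) (hu : u ≠ 0) (hre : 0 ≤ u.re) :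
    0 ≤ (a * u ^ k).re := by
  have hray : Tendsto (fun R : ℝ => (R : ℂ) * u) atTop (cobounded ℂ) := by
    rw [← tendsto_norm_atTop_iff_cobounded]
    simp only [norm_mul, Complex.norm_real, Real.norm_eq_abs]
    exact tendsto_abs_atTop_atTop.atTop_mul_const (norm_pos_iff.mpr hu)
  have hlim := (Complex.continuous_re.tendsto _).comp ((h.comp hray).mul_const (u ^ k))
  refine ge_of_tendsto hlim ?_
  filter_upwards [eventually_gt_atTop (0 : ℝ)] with R hR
  have hR' : (R : ℂ) ≠ 0 := by exact_mod_cast hR.ne'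
  have hquot : f (R * u) / (R * u) ^ k * u ^ k = f (R * u) / ((R ^ k : ℝ) : ℂ) := by
    push_cast
    field_simp
    ring
  simp only [Function.comp_apply, hquot, Complex.div_ofReal_re]
  refine div_nonneg (hf _ ?_) (by positivity)
  rw [Complex.re_ofReal_mul]
  positivity

/-- If `a * u ^ k` has nonnegative real part for all `u ≠ 0` in the closed right half plane,
where `a` is a nonzero real number, then `a` is positive and `k ≤ 1`. -/
theorem pos_and_le_one_of_re_mul_pow_nonneg {a : ℝ} {k : ℕ} (ha : a ≠ 0)
    (h : ∀ u : ℂ, u ≠ 0 → 0 ≤ u.re → 0 ≤ ((a : ℂ) * u ^ k).re) : 0 < a ∧ k ≤ 1 := by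
  have ha0 : 0 < a := lt_of_le_of_ne (by simpa using h 1 one_ne_zero (by simp)) ha.symm
  refine ⟨ha0, ?_⟩
  by_contra! hk
  have hk2 : (2 : ℝ) ≤ k := by exact_mod_cast hk
  have hk0 : (k : ℂ) ≠ 0 := by exact_mod_cast (by omega : k ≠ 0)
  have hpow : Complex.exp ((Real.pi / k : ℝ) * Complex.I) ^ k = -1 := by
    rw [← Complex.exp_nat_mul, ← Complex.exp_pi_mul_I]
    congr 1
    push_cast
    field_simp
  have hneg := h (Complex.exp ((Real.pi / k : ℝ) * Complex.I)) (Complex.exp_ne_zero _) (by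
    rw [Complex.exp_ofReal_mul_I_re]
    apply Real.cos_nonneg_of_neg_pi_div_two_le_of_le
    · have : 0 ≤ Real.pi / k := by positivity
      linarith [Real.pi_pos]
    · exact div_le_div_of_nonneg_left Real.pi_pos.le two_pos hk2)
  rw [hpow] at hneg
  simp at hneg
  linarith

open Filter Topology Bornology in
/-- Behaviour at infinity of a strictly positive real quotient whose numerator has degree at
least that of its denominator: it differs from `c * s` by a quantity with limit `b`, where
`c ≥ 0` and `b > 0`. -/
theorem IsStrictPosReal.exists_tendsto_sub_mul {p d : ℝ[X]} (h : IsStrictPosReal p d)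
    (hp : p ≠ 0) (hdeg : d.natDegree ≤ p.natDegree) :
    ∃ c b : ℝ, 0 ≤ c ∧ 0 < b ∧
      Tendsto (fun s : ℂ => aeval s p / aeval s d - c * s) (cobounded ℂ) (𝓝 (b : ℂ)) := by
  obtain ⟨ε, hε, h⟩ := h
  have hd : d ≠ 0 := by
    rintro rfl
    exact (h 0 (by simpa using hε)).1 (by simp)
  obtain ⟨k, hk⟩ := Nat.exists_eq_add_of_le hdeg
  have hld : d.leadingCoeff ≠ 0 := leadingCoeff_ne_zero.mpr hd
  have hlp : p.leadingCoeff ≠ 0 := leadingCoeff_ne_zero.mpr hp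
  have hcoeff : (d * X ^ k).coeff p.natDegree = d.leadingCoeff := by
    rw [hk, coeff_mul_X_pow, leadingCoeff]
  have hlim : Tendsto (fun s : ℂ => aeval s p / aeval s d / s ^ k) (cobounded ℂ)
      (𝓝 ((p.leadingCoeff / d.leadingCoeff : ℝ) : ℂ)) := by
    have := tendsto_aeval_div_aeval_cobounded (p := p) (q := d * X ^ k) le_rfl
      (by rw [natDegree_mul_X_pow _ hd, hk]) (by rwa [hcoeff])
    rw [hcoeff, coeff_natDegree] at this
    simpa only [map_mul, map_pow, aeval_X, div_div] using this
  obtain ⟨ha, hk1⟩ := pos_and_le_one_of_re_mul_pow_nonneg (div_ne_zero hlp hld)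
    fun u hu hre => re_mul_pow_nonneg_of_tendsto_div_pow
      (fun s hs => (h s (by linarith)).2) hlim hu hre
  obtain rfl | rfl : k = 0 ∨ k = 1 := by omega
  · exact ⟨0, _, le_rfl, ha, by simpa using hlim⟩
  set c := p.leadingCoeff / d.leadingCoeff with hc
  have hdegsub : (p - C c * (d * X)).natDegree ≤ d.natDegree := by
    have hdX : (C c * (d * X)).natDegree ≤ d.natDegree + 1 :=
      (natDegree_C_mul_le _ _).trans (natDegree_mul_X hd).le
    refine natDegree_le_iff_coeff_eq_zero.mpr fun N hN => ?_
    rcases (Nat.succ_le_of_lt hN).eq_or_lt with rfl | hN'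
    · rw [coeff_sub, coeff_C_mul, Nat.succ_eq_add_one, coeff_mul_X, ← hk]
      change p.leadingCoeff - c * d.leadingCoeff = 0
      rw [hc]
      field_simp
      ring
    · rw [coeff_sub, coeff_eq_zero_of_natDegree_lt (by omega),
        coeff_eq_zero_of_natDegree_lt (by omega), sub_zero]
  have hlimb := tendsto_aeval_div_aeval_cobounded hdegsub le_rfl hld
  set b := (p - C c * (d * X)).coeff d.natDegree / d.coeff d.natDegree
  have hvert : Tendsto (fun R : ℝ => (-(ε / 2) : ℂ) + R * Complex.I) atTop (cobounded ℂ) := by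
    refine tendsto_const_add_cobounded _ |>.comp ?_
    rw [← tendsto_norm_atTop_iff_cobounded]
    simpa using tendsto_abs_atTop_atTop
  have hb : c * (ε / 2) ≤ b := by
    have hre := (Complex.continuous_re.tendsto _).comp (hlimb.comp hvert)
    refine ge_of_tendsto' hre fun R => ?_
    set s : ℂ := -(ε / 2) + R * Complex.I with hs
    have hsre : s.re = -(ε / 2) := by simp [hs]
    obtain ⟨hds, hpos⟩ := h s (by linarith)
    have hquot : aeval s (p - C c * (d * X)) / aeval s d = aeval s p / aeval s d - c * s := by
      simp only [map_sub, map_mul, aeval_C, aeval_X, Complex.coe_algebraMap]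
      field_simp
    simp only [Function.comp_apply, ← hs, hquot, Complex.sub_re, Complex.re_ofReal_mul, hsre]
    linarith
  refine ⟨c, b, ha.le, lt_of_lt_of_le (by positivity) hb, hlimb.congr' ?_⟩
  have hne : ∀ᶠ s in cobounded ℂ, aeval s p / aeval s d / s ^ 1 ≠ 0 :=
    hlim.eventually_ne (by exact_mod_cast ha.ne')
  filter_upwards [hne] with s hs
  have hds : aeval s d ≠ 0 := fun h0 => hs (by simp [h0])
  simp only [map_sub, map_mul, aeval_C, aeval_X, Complex.coe_algebraMap]
  field_simp

open Filter Topology Bornology in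
/-- A holomorphic function with nonnegative real part on a half plane `Re s > -ε`, whose real
part is bounded below by a positive constant near infinity in the closed right half plane, has
real part bounded below by a positive constant on the closed right half plane. -/
theorem AnalyticOnNhd.exists_pos_le_re {f : ℂ → ℂ} {ε β : ℝ} (hε : 0 < ε)
    (hf : AnalyticOnNhd ℂ f {s | -ε < s.re}) (hpos : ∀ s : ℂ, -ε < s.re → 0 ≤ (f s).re)
    (hβ : 0 < β) (hinf : ∀ᶠ s in cobounded ℂ, 0 ≤ s.re → β ≤ (f s).re) :
    ∃ δ > (0 : ℝ), ∀ s : ℂ, 0 ≤ s.re → δ ≤ (f s).re := by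
  have hmem : ∀ s : ℂ, 0 ≤ s.re → s ∈ {s : ℂ | -ε < s.re} := fun s hs =>
    (neg_lt_zero.mpr hε).trans_le hs
  have hstrict : ∀ s : ℂ, 0 ≤ s.re → 0 < (f s).re := by
    intro s hs
    refine (hpos s (hmem s hs)).lt_of_ne fun h0 => ?_
    rcases hf.is_constant_or_isOpen (convex_halfSpace_re_gt (-ε)).isPreconnected with
      ⟨w, hw⟩ | hopen
    · have hreal := RCLike.tendsto_ofReal_atTop_cobounded (𝕜 := ℂ) |>.eventually hinf
      obtain ⟨R, hR, hR0⟩ := (hreal.and (eventually_ge_atTop 0)).exists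
      have hRre : (0 : ℝ) ≤ ((R : ℂ)).re := by simpa using hR0
      have := hR hRre
      rw [hw s (hmem s hs)] at h0
      change β ≤ (f (R : ℂ)).re at this
      rw [hw _ (hmem _ hRre)] at this
      linarith
    · have himg := Complex.isOpenMap_re _
        (hopen _ subset_rfl (isOpen_lt continuous_const Complex.continuous_re))
      have h0mem : (0 : ℝ) ∈ Complex.re '' (f '' {s : ℂ | -ε < s.re}) :=
        ⟨f s, ⟨s, hmem s hs, rfl⟩, h0.symm⟩
      obtain ⟨r, hr, hball⟩ := Metric.isOpen_iff.mp himg 0 h0mem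
      obtain ⟨_, ⟨z, hz, rfl⟩, hzr⟩ := hball (show -(r / 2) ∈ Metric.ball 0 r by
        simp [abs_of_pos hr, hr])
      linarith [hpos z hz]
  obtain ⟨R, -, hR⟩ := hasBasis_cobounded_norm.eventually_iff.mp hinf
  have hK : IsCompact (Metric.closedBall (0 : ℂ) R ∩ {s | 0 ≤ s.re}) :=
    (isCompact_closedBall 0 R).inter_right (isClosed_le continuous_const Complex.continuous_re)
  have hcont : ContinuousOn (fun s => (f s).re) (Metric.closedBall (0 : ℂ) R ∩ {s | 0 ≤ s.re}) :=
    Complex.continuous_re.comp_continuousOn (hf.continuousOn.mono fun s hs => hmem s hs.2)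
  obtain ⟨μ, hμ, hμle⟩ := hK.exists_forall_le' hcont (a := 0) fun s hs => hstrict s hs.2
  refine ⟨min β μ, lt_min hβ hμ, fun s hs => ?_⟩
  rcases le_total R ‖s‖ with hsR | hsR
  · exact (min_le_left _ _).trans (hR hsR hs)
  · exact (min_le_right _ _).trans (hμle s ⟨by simpa using hsR, hs⟩)

/-- Let `m ≥ 1`, let `x 1, …, x m ∈ ℂ` be distinct, in the open left half plane, and
closed under conjugation (so `η = ∏ j (X - x j)` has real coefficients, witnessed by
`ηr ∈ ℝ[X]`), and let `d ∈ ℝ[X]` of degree at most `m` be such that `(η, d)` is strictly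
positive real.  Then the real part of `Δ = η/d` is bounded away from zero on the open
right half plane: `Re (η(s)/d(s)) ≥ δ` there, for some `δ > 0`. -/
theorem statement14 (m : ℕ) (hm : 1 ≤ m) (x : Fin m → ℂ) (hx : Function.Injective x)
    (hre : ∀ j, (x j).re < 0)
    (σ : Fin m → Fin m) (hσ : ∀ j, x (σ j) = starRingEnd ℂ (x j))
    (ηr : Polynomial ℝ) (hηr : ηr.map (algebraMap ℝ ℂ) = ∏ j, (X - C (x j)))
    (d : Polynomial ℝ) (hd : d.degree ≤ (m : ℕ))
    (hspr : IsStrictPosReal ηr d) :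
    ∃ δ > (0 : ℝ), ∀ s : ℂ, 0 < s.re →
      δ ≤ ((Polynomial.aeval s) ηr / (Polynomial.aeval s) d).re := by
  have hdegη : ηr.natDegree = m := by
    rw [← natDegree_map (algebraMap ℝ ℂ), hηr, natDegree_prod_of_monic _ _ fun j _ =>
      monic_X_sub_C (x j)]
    simp
  have hη : ηr ≠ 0 := by
    rintro rfl
    rw [Polynomial.map_zero] at hηr
    exact (monic_prod_of_monic _ _ fun j _ => monic_X_sub_C (x j)).ne_zero hηr.symm
  obtain ⟨c, b, hc, hb, hlim⟩ := hspr.exists_tendsto_sub_mul hη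
    (hdegη.symm ▸ natDegree_le_of_degree_le hd)
  obtain ⟨ε, hε, hspr⟩ := hspr
  obtain ⟨δ, hδ, hle⟩ := AnalyticOnNhd.exists_pos_le_re
    (f := fun s => aeval s ηr / aeval s d) hε
    (fun s hs => (analyticAt_id.aeval_polynomial ηr).div
      (analyticAt_id.aeval_polynomial d) (hspr s hs).1)
    (fun s hs => (hspr s hs).2) (half_pos hb) (by
      have hre := (Complex.continuous_re.tendsto _).comp hlim
      filter_upwards [hre.eventually_const_lt (show b / 2 < (b : ℂ).re by simpa using hb)]
        with s hs hs0
      simp only [Function.comp_apply, Complex.sub_re, Complex.re_ofReal_mul] at hs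
      linarith [mul_nonneg hc hs0])
  exact ⟨δ, hδ, fun s hs => hle s hs.le⟩
end

section
/- Let m ≥ 1, let x_1, …, x_m ∈ ℂ be distinct with Re x_j < 0 for all j and closed under complex conjugation, let d ∈ ℝ[X] with degree at most m be such that the pair (η, d) is strictly positive real, and let ν ∈ ℝ[X] with deg ν ≤ deg d. Define r̲ as the supremum of the set { −Re(ν(s)/d(s)) / Re(η(s)/d(s)) : s ∈ ℂ, Re s > 0 }. Then for every r ∈ ℝ, the pair (ν + r·η, d) is positive real if and only if r ≥ r̲. -/
open Polynomial Finset

open Filter Bornology Topology in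
theorem tendsto_aeval_div_pow_cobounded {p : ℝ[X]} {N : ℕ} (hp : p.natDegree ≤ N) :
    Tendsto (fun s : ℂ => aeval s p / s ^ N) (cobounded ℂ) (𝓝 (p.coeff N : ℂ)) := by
  have hne : ∀ᶠ s : ℂ in cobounded ℂ, s ≠ 0 := eventually_ne_cobounded 0
  have key : Tendsto (fun s : ℂ => ∑ i ∈ range (N + 1), (p.coeff i : ℂ) * (s⁻¹) ^ (N - i))
      (cobounded ℂ) (𝓝 (∑ i ∈ range (N + 1), (p.coeff i : ℂ) * 0 ^ (N - i))) :=
    tendsto_finsetSum _ fun i _ => (tendsto_inv₀_cobounded.pow _).const_mul _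
  have hlim : ∑ i ∈ range (N + 1), (p.coeff i : ℂ) * 0 ^ (N - i) = p.coeff N := by
    rw [sum_range_succ, sum_eq_zero]
    · simp
    · intro i hi
      have : N - i ≠ 0 := by have := mem_range.1 hi; omega
      simp [this]
  rw [hlim] at key
  refine key.congr' ?_
  filter_upwards [hne] with s hs
  rw [aeval_eq_sum_range' (Nat.lt_succ_of_le hp), sum_div]
  refine sum_congr rfl fun i hi => ?_
  have hi' : i ≤ N := by have := mem_range.1 hi; omega
  have hpow : s ^ N = s ^ i * s ^ (N - i) := by rw [← pow_add, Nat.add_sub_cancel' hi']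
  rw [hpow, Complex.real_smul, inv_pow]
  field_simp

open Filter Bornology Topology in
theorem tendsto_aeval_div_aeval_cobounded_s15 {p d : ℝ[X]} (hd : d ≠ 0) (h : p.degree ≤ d.degree) :
    Tendsto (fun s : ℂ => aeval s p / aeval s d) (cobounded ℂ)
      (𝓝 ((p.coeff d.natDegree : ℂ) / (d.leadingCoeff : ℂ))) := by
  have hne : ∀ᶠ s : ℂ in cobounded ℂ, s ≠ 0 := eventually_ne_cobounded 0
  have hl : (d.leadingCoeff : ℂ) ≠ 0 := by simpa using hd
  refine ((tendsto_aeval_div_pow_cobounded (natDegree_le_natDegree h)).div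
    (tendsto_aeval_div_pow_cobounded le_rfl) hl).congr' ?_
  filter_upwards [hne] with s hs
  exact div_div_div_cancel_right₀ (pow_ne_zero _ hs) _ _

open Filter Bornology Topology in
theorem tendsto_ofReal_mul_cobounded {w : ℂ} (hw : w ≠ 0) :
    Tendsto (fun t : ℝ => (t : ℂ) * w) atTop (cobounded ℂ) := by
  rw [← tendsto_norm_atTop_iff_cobounded]
  simp only [norm_mul, Complex.norm_real]
  exact tendsto_norm_atTop_atTop.atTop_mul_const (norm_pos_iff.2 hw)

open Filter Bornology Topology in
/-- Along a ray in the closed right half-plane, the leading term of a real polynomial with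
asymptotically nonnegative real part has nonnegative real part. -/
theorem re_leadingCoeff_mul_pow_nonneg {q : ℝ[X]} {P : ℂ → ℂ}
    (hP : Tendsto P (cobounded ℂ) (𝓝 0)) (h : ∀ s : ℂ, 0 ≤ s.re → 0 ≤ (aeval s q + P s).re)
    {w : ℂ} (hw : w ≠ 0) (hwre : 0 ≤ w.re) :
    0 ≤ ((q.leadingCoeff : ℂ) * w ^ q.natDegree).re := by
  have h1 : Tendsto (fun s : ℂ => aeval s q / s ^ q.natDegree + P s * s⁻¹ ^ q.natDegree)
      (cobounded ℂ) (𝓝 (q.leadingCoeff : ℂ)) := by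
    simpa using (tendsto_aeval_div_pow_cobounded (le_refl q.natDegree)).add
      (hP.mul (tendsto_inv₀_cobounded.pow q.natDegree))
  have h2 := (h1.comp (tendsto_ofReal_mul_cobounded hw)).mul_const (w ^ q.natDegree)
  refine ge_of_tendsto ((Complex.continuous_re.tendsto _).comp h2) ?_
  filter_upwards [eventually_gt_atTop 0] with t ht
  have ht' : (t : ℂ) ≠ 0 := by exact_mod_cast ht.ne'
  have heq : (aeval ((t : ℂ) * w) q / ((t : ℂ) * w) ^ q.natDegree
      + P (t * w) * ((t : ℂ) * w)⁻¹ ^ q.natDegree) * w ^ q.natDegree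
      = (((t ^ q.natDegree)⁻¹ : ℝ) : ℂ) * (aeval ((t : ℂ) * w) q + P (t * w)) := by
    push_cast
    rw [mul_pow, inv_pow, mul_pow]
    field_simp
  simp only [Function.comp_apply, heq, Complex.re_ofReal_mul]
  refine mul_nonneg (by positivity) (h _ ?_)
  rw [Complex.re_ofReal_mul]
  positivity

open Filter Bornology Topology in
/-- A nonzero real polynomial whose real part is asymptotically nonnegative on the closed right
half-plane has positive leading coefficient and degree at most one. -/
theorem natDegree_le_one_of_re_nonneg {q : ℝ[X]} (hq : q ≠ 0) {P : ℂ → ℂ}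
    (hP : Tendsto P (cobounded ℂ) (𝓝 0)) (h : ∀ s : ℂ, 0 ≤ s.re → 0 ≤ (aeval s q + P s).re) :
    0 < q.leadingCoeff ∧ q.natDegree ≤ 1 := by
  have ha : 0 < q.leadingCoeff := by
    refine lt_of_le_of_ne ?_ (leadingCoeff_ne_zero.2 hq).symm
    simpa using re_leadingCoeff_mul_pow_nonneg hP h one_ne_zero (by simp)
  refine ⟨ha, ?_⟩
  by_contra! hn
  have hn0 : (q.natDegree : ℂ) ≠ 0 := by exact_mod_cast (by omega : q.natDegree ≠ 0)
  have hre : 0 ≤ (Complex.exp (((Real.pi / q.natDegree : ℝ) : ℂ) * Complex.I)).re := by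
    rw [Complex.exp_ofReal_mul_I_re]
    have h2 : (2 : ℝ) ≤ q.natDegree := by exact_mod_cast hn
    refine Real.cos_nonneg_of_neg_pi_div_two_le_of_le ?_ ?_
    · have : 0 ≤ Real.pi / q.natDegree := by positivity
      linarith [Real.pi_pos]
    · gcongr
  have := re_leadingCoeff_mul_pow_nonneg hP h (Complex.exp_ne_zero _) hre
  rw [← Complex.exp_nat_mul] at this
  have harg : (q.natDegree : ℂ) * (((Real.pi / q.natDegree : ℝ) : ℂ) * Complex.I)
      = Real.pi * Complex.I := by
    push_cast
    field_simp
  rw [harg, Complex.exp_pi_mul_I] at this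
  simp at this
  linarith

open Filter Bornology Topology in
theorem exists_pos_le_re_aeval {q : ℝ[X]} (hq : q ≠ 0) {P : ℂ → ℂ}
    (hP : Tendsto P (cobounded ℂ) (𝓝 0)) {ε : ℝ} (hε : 0 < ε)
    (h : ∀ s : ℂ, -ε < s.re → 0 ≤ (aeval s q + P s).re) :
    ∃ δ > 0, ∀ s : ℂ, 0 ≤ s.re → δ ≤ (aeval s q).re := by
  obtain ⟨ha, hn⟩ := natDegree_le_one_of_re_nonneg hq hP fun s hs => h s (by linarith)
  obtain ⟨k, c, rfl⟩ : ∃ k c, q = C k * X + C c := ⟨_, _, eq_X_add_C_of_natDegree_le_one hn⟩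
  have hval : ∀ s : ℂ, (aeval s (C k * X + C c)).re = k * s.re + c := by
    intro s
    simp
  have hk : 0 ≤ k := by
    by_contra! hk
    rw [leadingCoeff_linear hk.ne] at ha
    exact hk.not_gt ha
  have hline : Tendsto (fun t : ℝ => ((-(ε / 2) : ℝ) : ℂ) + (t : ℂ) * Complex.I) atTop
      (cobounded ℂ) := by
    rw [← tendsto_norm_atTop_iff_cobounded]
    refine tendsto_atTop_mono (fun t => ?_) tendsto_id
    refine le_trans (le_abs_self t) ?_
    simpa using Complex.abs_im_le_norm (((-(ε / 2) : ℝ) : ℂ) + (t : ℂ) * Complex.I)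
  have hlim : Tendsto (fun t : ℝ => k * (-(ε / 2)) + c
      + (P (((-(ε / 2) : ℝ) : ℂ) + (t : ℂ) * Complex.I)).re) atTop
      (𝓝 (k * (-(ε / 2)) + c + 0)) :=
    ((Complex.continuous_re.tendsto _).comp (hP.comp hline)).const_add _
  have hc : 0 ≤ k * (-(ε / 2)) + c + 0 := by
    refine ge_of_tendsto' hlim fun t => ?_
    have := h (((-(ε / 2) : ℝ) : ℂ) + (t : ℂ) * Complex.I) (by simp; linarith)
    rw [Complex.add_re, hval] at this
    simpa using this
  have hc0 : 0 < c := by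
    rcases hk.eq_or_lt with rfl | hk
    · simpa using ha
    · nlinarith [mul_pos hk hε]
  refine ⟨c, hc0, fun s hs => ?_⟩
  rw [hval]
  nlinarith [mul_nonneg hk hs]

open Filter Bornology Topology in
/-- If `(η, d)` is strictly positive real with `deg d ≤ deg η`, then `Re (η / d)` is bounded below
by a positive constant near infinity in the closed right half-plane. -/
theorem exists_pos_eventually_le_re_div {η d : ℝ[X]} (hdeg : d.degree ≤ η.degree)
    {ε : ℝ} (hε : 0 < ε)
    (h : ∀ s : ℂ, -ε < s.re → aeval s d ≠ 0 ∧ 0 ≤ (aeval s η / aeval s d).re) :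
    ∃ δ > 0, ∀ᶠ s : ℂ in cobounded ℂ, 0 ≤ s.re → δ ≤ (aeval s η / aeval s d).re := by
  have hd : d ≠ 0 := by
    rintro rfl
    simpa using (h 0 (by simpa using hε)).1
  have hq : η / d ≠ 0 := by
    rw [Ne, Polynomial.div_eq_zero_iff hd]
    exact hdeg.not_gt
  have hP : Tendsto (fun s : ℂ => aeval s (η % d) / aeval s d) (cobounded ℂ) (𝓝 0) := by
    have hlt := degree_mod_lt η hd
    have := tendsto_aeval_div_aeval_cobounded_s15 hd hlt.le
    rwa [coeff_eq_zero_of_degree_lt (by rwa [← degree_eq_natDegree hd]), Complex.ofReal_zero,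
      zero_div] at this
  have hsplit : ∀ s : ℂ, aeval s d ≠ 0 →
      aeval s η / aeval s d = aeval s (η / d) + aeval s (η % d) / aeval s d := by
    intro s hs
    have := congrArg (aeval s) (EuclideanDomain.div_add_mod η d)
    rw [map_add, map_mul] at this
    rw [← this]
    field_simp
  obtain ⟨δ, hδ, hle⟩ := exists_pos_le_re_aeval hq hP hε fun s hs => by
    rw [← hsplit s (h s hs).1]
    exact (h s hs).2
  refine ⟨δ / 2, half_pos hδ, ?_⟩
  have hsmall : ∀ᶠ s : ℂ in cobounded ℂ, -(δ / 2) < (aeval s (η % d) / aeval s d).re :=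
    ((Complex.continuous_re.tendsto _).comp hP).eventually_const_lt (by simpa using hδ)
  filter_upwards [hsmall] with s hs hre
  rw [hsplit s (h s (by linarith)).1, Complex.add_re]
  linarith [hle s hre]

/-- Open mapping: a nonnegative real part of `η / d` is in fact positive. -/
theorem re_aeval_div_aeval_pos {η d : ℝ[X]} (h0 : aeval (0 : ℂ) η ≠ 0) {ε : ℝ} (hε : 0 < ε)
    (h : ∀ s : ℂ, -ε < s.re → aeval s d ≠ 0 ∧ 0 ≤ (aeval s η / aeval s d).re)
    {s : ℂ} (hs : -ε < s.re) : 0 < (aeval s η / aeval s d).re := by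
  have hopen : IsOpen {z : ℂ | -ε < z.re} := isOpen_lt continuous_const Complex.continuous_re
  have hanal : AnalyticOnNhd ℂ (fun z : ℂ => aeval z η / aeval z d) {z : ℂ | -ε < z.re} :=
    DifferentiableOn.analyticOnNhd (fun z hz => ((Polynomial.differentiable_aeval η z).div
      (Polynomial.differentiable_aeval d z) (h z hz).1).differentiableWithinAt) hopen
  rcases hanal.is_constant_or_isOpen (convex_halfSpace_re_gt (-ε)).isPreconnected with ⟨w, hw⟩ | ho
  · have hmem : (0 : ℂ) ∈ {z : ℂ | -ε < z.re} := by simpa using hε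
    have hreal : aeval (0 : ℂ) η / aeval (0 : ℂ) d = ((η.eval 0 / d.eval 0 : ℝ) : ℂ) := by
      have (p : ℝ[X]) : aeval (0 : ℂ) p = ((p.eval 0 : ℝ) : ℂ) := by
        simpa using aeval_algebraMap_apply ℂ (0 : ℝ) p
      rw [this, this, Complex.ofReal_div]
    have hne : aeval (0 : ℂ) η / aeval (0 : ℂ) d ≠ 0 := div_ne_zero h0 (h 0 hmem).1
    have hnn := (h 0 hmem).2
    have hs0 : aeval s η / aeval s d = aeval (0 : ℂ) η / aeval (0 : ℂ) d :=
      (hw s hs).trans (hw 0 hmem).symm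
    rw [hs0]
    rw [hreal] at hne hnn ⊢
    rw [Complex.ofReal_re] at hnn ⊢
    exact lt_of_le_of_ne hnn fun he => hne (by rw [← he, Complex.ofReal_zero])
  · have hsub : (fun z : ℂ => aeval z η / aeval z d) '' {z : ℂ | -ε < z.re} ⊆ {z | 0 ≤ z.re} := by
      rintro _ ⟨z, hz, rfl⟩
      exact (h z hz).2
    have := interior_maximal hsub (ho _ subset_rfl hopen) ⟨s, hs, rfl⟩
    rwa [Complex.interior_setOfPred_le_re] at this

open Filter Bornology Topology in
theorem exists_pos_le_re_div {η d : ℝ[X]} (h0 : aeval (0 : ℂ) η ≠ 0)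
    (hdeg : d.degree ≤ η.degree) (h : IsStrictPosReal η d) :
    ∃ δ > 0, ∀ s : ℂ, 0 ≤ s.re → δ ≤ (aeval s η / aeval s d).re := by
  obtain ⟨ε, hε, h⟩ := h
  obtain ⟨δ₁, hδ₁, hinf⟩ := exists_pos_eventually_le_re_div hdeg hε h
  obtain ⟨R, -, hR⟩ := (hasBasis_cobounded_norm (E := ℂ)).eventually_iff.1 hinf
  have hK : IsCompact (Metric.closedBall (0 : ℂ) |R| ∩ {s : ℂ | 0 ≤ s.re}) :=
    (isCompact_closedBall 0 |R|).inter_right (isClosed_le continuous_const Complex.continuous_re)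
  have hcont : ContinuousOn (fun s : ℂ => (aeval s η / aeval s d).re)
      (Metric.closedBall (0 : ℂ) |R| ∩ {s : ℂ | 0 ≤ s.re}) :=
    Complex.continuous_re.comp_continuousOn <| (Polynomial.continuous_aeval η).continuousOn.div
      (Polynomial.continuous_aeval d).continuousOn fun s hs => (h s (by have := hs.2; simp at this; linarith)).1
  obtain ⟨s₀, hs₀, hmin⟩ := hK.exists_isMinOn ⟨0, by simp⟩ hcont
  have hs₀' : -ε < s₀.re := by have := hs₀.2; simp at this; linarith
  refine ⟨min δ₁ _, lt_min hδ₁ (re_aeval_div_aeval_pos h0 hε h hs₀'), fun s hs => ?_⟩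
  rcases le_total |R| ‖s‖ with hsR | hsR
  · exact (min_le_left _ _).trans (hR ((le_abs_self R).trans hsR) hs)
  · exact (min_le_right _ _).trans (hmin ⟨by simpa using hsR, hs⟩)

open Filter Bornology Topology in
theorem exists_norm_aeval_div_le {ν d : ℝ[X]} (hdeg : ν.degree ≤ d.degree)
    (h : ∀ s : ℂ, 0 ≤ s.re → aeval s d ≠ 0) :
    ∃ M, ∀ s : ℂ, 0 ≤ s.re → ‖aeval s ν / aeval s d‖ ≤ M := by
  have hd : d ≠ 0 := by
    rintro rfl
    simpa using h 0 le_rfl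
  obtain ⟨M₁, hinf⟩ := (tendsto_aeval_div_aeval_cobounded_s15 hd hdeg).norm.isBoundedUnder_le
  obtain ⟨R, -, hR⟩ := (hasBasis_cobounded_norm (E := ℂ)).eventually_iff.1 (eventually_map.1 hinf)
  have hK : IsCompact (Metric.closedBall (0 : ℂ) R ∩ {s : ℂ | 0 ≤ s.re}) :=
    (isCompact_closedBall 0 R).inter_right (isClosed_le continuous_const Complex.continuous_re)
  obtain ⟨M₂, hM₂⟩ := hK.exists_bound_of_continuousOn <|
    (Polynomial.continuous_aeval ν).continuousOn.div (Polynomial.continuous_aeval d).continuousOn fun s hs => h s hs.2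
  refine ⟨max M₁ M₂, fun s hs => ?_⟩
  rcases le_total R ‖s‖ with hsR | hsR
  · exact (hR hsR).trans (le_max_left _ _)
  · exact (hM₂ s ⟨by simpa using hsR, hs⟩).trans (le_max_right _ _)

/-- Let `m ≥ 1`, let `x 1, …, x m ∈ ℂ` be distinct, in the open left half plane, and
closed under conjugation (so `η = ∏ j (X - x j)` has real coefficients, witnessed by
`ηr ∈ ℝ[X]`), let `d ∈ ℝ[X]` of degree at most `m` be such that `(η, d)` is strictly
positive real, and let `ν ∈ ℝ[X]` with `deg ν ≤ deg d`.  With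
`r̲ = sup { -Re (ν(s)/d(s)) / Re (η(s)/d(s)) : Re s > 0 }`, the pair `(ν + r·η, d)` is
positive real if and only if `r ≥ r̲`. -/
theorem statement15 (m : ℕ) (hm : 1 ≤ m) (x : Fin m → ℂ) (hx : Function.Injective x)
    (hre : ∀ j, (x j).re < 0)
    (σ : Fin m → Fin m) (hσ : ∀ j, x (σ j) = starRingEnd ℂ (x j))
    (ηr : Polynomial ℝ) (hηr : ηr.map (algebraMap ℝ ℂ) = ∏ j, (X - C (x j)))
    (d : Polynomial ℝ) (hd : d.degree ≤ (m : ℕ))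
    (hspr : IsStrictPosReal ηr d)
    (ν : Polynomial ℝ) (hν : ν.degree ≤ d.degree) :
    ∀ r : ℝ, IsPosReal (ν + C r * ηr) d ↔
      sSup { t : ℝ | ∃ s : ℂ, 0 < s.re ∧
        t = -((Polynomial.aeval s) ν / (Polynomial.aeval s) d).re /
          ((Polynomial.aeval s) ηr / (Polynomial.aeval s) d).re } ≤ r := by
  have hmonic : ηr.Monic :=
    (monic_map_iff (f := algebraMap ℝ ℂ)).1 (hηr ▸ monic_prod_X_sub_C x univ)
  have hdeg : ηr.degree = m := by
    rw [← degree_map ηr (algebraMap ℝ ℂ), hηr, degree_prod]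
    simp
  have h0 : aeval (0 : ℂ) ηr ≠ 0 := by
    rw [← eval_map_algebraMap, hηr, eval_prod, prod_ne_zero_iff]
    intro j _ hj
    have := hre j
    simp only [eval_sub, eval_X, eval_C, zero_sub, neg_eq_zero] at hj
    simp [hj] at this
  obtain ⟨δ, hδ, hδle⟩ := exists_pos_le_re_div h0 (hd.trans hdeg.ge) hspr
  have hdne : ∀ s : ℂ, 0 ≤ s.re → aeval s d ≠ 0 := by
    obtain ⟨ε, hε, h⟩ := hspr
    exact fun s hs => (h s (by linarith)).1
  have hd0 : d ≠ 0 := by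
    rintro rfl
    simpa using hdne 0 le_rfl
  obtain ⟨M, hM⟩ := exists_norm_aeval_div_le hν hdne
  intro r
  have hM0 : 0 ≤ M := (norm_nonneg _).trans (hM 0 le_rfl)
  rw [csSup_le_iff]
  · constructor
    · rintro ⟨-, h⟩ _ ⟨s, hs, rfl⟩
      rw [div_le_iff₀ (hδ.trans_le (hδle s hs.le))]
      have := (h s hs).2
      rw [map_add, map_mul, aeval_C, add_div, mul_div_assoc, Complex.add_re,
        Complex.coe_algebraMap, Complex.re_ofReal_mul] at this
      linarith
    · refine fun h => ⟨hd0, fun s hs => ⟨hdne s hs.le, ?_⟩⟩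
      have := h _ ⟨s, hs, rfl⟩
      rw [div_le_iff₀ (hδ.trans_le (hδle s hs.le))] at this
      rw [map_add, map_mul, aeval_C, add_div, mul_div_assoc, Complex.add_re,
        Complex.coe_algebraMap, Complex.re_ofReal_mul]
      linarith
  · refine ⟨M / δ, ?_⟩
    rintro _ ⟨s, hs, rfl⟩
    refine div_le_div₀ hM0 ?_ hδ (hδle s hs.le)
    exact ((neg_le_abs _).trans (Complex.abs_re_le_norm _)).trans (hM s hs.le)
  · exact ⟨_, 1, by simp, rfl⟩
end

section
/- Let m ≥ 1, let x_1, …, x_m ∈ ℂ be distinct with Re x_j < 0 for all j and closed under complex conjugation, let d ∈ ℝ[X] with degree at most m be such that the pair (η, d) is strictly positive real, and let ν ∈ ℝ[X] with deg ν ≤ deg d and deg ν ≤ m − 1. Then the threshold r̲, defined as the supremum of the set { −Re(ν(s)/d(s)) / Re(η(s)/d(s)) : s ∈ ℂ, Re s > 0 }, satisfies r̲ ≥ 0. -/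
open Polynomial Finset

/-- Let `m ≥ 1`, let `x 1, …, x m ∈ ℂ` be distinct, in the open left half plane, and
closed under conjugation (so `η = ∏ j (X - x j)` has real coefficients, witnessed by
`ηr ∈ ℝ[X]`), let `d ∈ ℝ[X]` of degree at most `m` be such that `(η, d)` is strictly
positive real, and let `ν ∈ ℝ[X]` with `deg ν ≤ deg d` and `deg ν ≤ m - 1`.  Then the
threshold `r̲ = sup { -Re (ν(s)/d(s)) / Re (η(s)/d(s)) : Re s > 0 }` is nonnegative. -/
theorem statement16 (m : ℕ) (hm : 1 ≤ m) (x : Fin m → ℂ) (hx : Function.Injective x)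
    (hre : ∀ j, (x j).re < 0)
    (σ : Fin m → Fin m) (hσ : ∀ j, x (σ j) = starRingEnd ℂ (x j))
    (ηr : Polynomial ℝ) (hηr : ηr.map (algebraMap ℝ ℂ) = ∏ j, (X - C (x j)))
    (d : Polynomial ℝ) (hd : d.degree ≤ (m : ℕ))
    (hspr : IsStrictPosReal ηr d)
    (ν : Polynomial ℝ) (hν : ν.degree ≤ d.degree)
    (hν' : ν.degree ≤ ((m - 1 : ℕ) : WithBot ℕ)) :
    0 ≤ sSup { t : ℝ | ∃ s : ℂ, 0 < s.re ∧
        t = -((Polynomial.aeval s) ν / (Polynomial.aeval s) d).re /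
          ((Polynomial.aeval s) ηr / (Polynomial.aeval s) d).re } := by
  set S := { t : ℝ | ∃ s : ℂ, 0 < s.re ∧
        t = -((Polynomial.aeval s) ν / (Polynomial.aeval s) d).re /
          ((Polynomial.aeval s) ηr / (Polynomial.aeval s) d).re }
  by_cases hb : BddAbove S
  · have hdeg : ηr.degree = m := by
      rw [← degree_map ηr (algebraMap ℝ ℂ), hηr, degree_prod]
      simp
    have hlt : ν.degree < ηr.degree := by
      rw [hdeg]
      exact hν'.trans_lt (by exact_mod_cast Nat.sub_lt hm one_pos)
    have hlim := (div_tendsto_atTop_zero_of_degree_lt ν ηr hlt).neg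
    rw [neg_zero] at hlim
    refine le_of_tendsto hlim ?_
    filter_upwards [Filter.eventually_gt_atTop 0] with r hr
    refine le_csSup hb ⟨(r : ℂ), by simpa using hr, ?_⟩
    obtain ⟨ε, hε, h⟩ := hspr
    have hd0 := (h (r : ℂ) (by simp; linarith)).1
    have aeval_real (p : ℝ[X]) : aeval (r : ℂ) p = ((p.eval r : ℝ) : ℂ) := by
      simpa using aeval_algebraMap_apply_eq_algebraMap_eval (A := ℂ) r p
    rw [aeval_real, Complex.ofReal_ne_zero] at hd0
    simp only [aeval_real, ← Complex.ofReal_div, Complex.ofReal_re]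
    rw [neg_div, div_div_div_cancel_right₀ hd0]
  · rw [Real.sSup_of_not_bddAbove hb]
end

section
/- Any set of m nodes in the open left half plane can be mapped to anywhere in ℂ by a positive real rational function of degree at most m: let m ≥ 1, let x_1, …, x_m ∈ ℂ be distinct with Re x_j < 0 for all j, and let y_1, …, y_m ∈ ℂ; assume the data is closed under complex conjugation, i.e. there is a map σ : {1, …, m} → {1, …, m} with x_{σ(j)} = conj(x_j) and y_{σ(j)} = conj(y_j) for every j. Then there exist polynomials ν, d ∈ ℝ[X], each of degree at most m, such that the pair (ν, d) is positive real and for every j ∈ {1, …, m} one has d(x_j) ≠ 0 and ν(x_j)/d(x_j) = y_j. -/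
open Polynomial

/-- A complex polynomial fixed by coefficientwise conjugation comes from a real one. -/
theorem exists_real_of_map_conj_eq {P : ℂ[X]} (h : P.map (starRingEnd ℂ) = P) :
    ∃ q : ℝ[X], q.map (algebraMap ℝ ℂ) = P := by
  have hP : P ∈ Polynomial.lifts (algebraMap ℝ ℂ) := by
    rw [Polynomial.lifts_iff_coeff_lifts]
    intro n
    have hn : starRingEnd ℂ (P.coeff n) = P.coeff n := by
      rw [← Polynomial.coeff_map, h]
    exact ⟨(P.coeff n).re, Complex.conj_eq_iff_re.1 hn⟩
  exact (Polynomial.mem_lifts P).1 hP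

/-- On the right half plane, `‖s - a‖` is comparable to `1 + ‖s‖` when `Re a < 0`. -/
theorem exists_one_add_norm_le_mul_norm_sub {a : ℂ} (ha : a.re < 0) :
    ∃ C : ℝ, ∀ s : ℂ, 0 < s.re → 1 + ‖s‖ ≤ C * ‖s - a‖ := by
  refine ⟨1 + (1 + ‖a‖) / (-a.re), fun s hs => ?_⟩
  have hr : 0 < -a.re := by linarith
  have hdist : -a.re ≤ ‖s - a‖ := by
    have := Complex.re_le_norm (s - a)
    rw [Complex.sub_re] at this
    linarith
  have htri : ‖s‖ ≤ ‖s - a‖ + ‖a‖ := by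
    simpa using norm_add_le (s - a) a
  have hmul : 1 + ‖a‖ ≤ (1 + ‖a‖) / (-a.re) * ‖s - a‖ := by
    rw [div_mul_eq_mul_div, le_div_iff₀ hr]
    gcongr
  linarith

theorem exists_one_add_norm_pow_le_mul_norm_prod {ι : Type*} [Fintype ι] (x : ι → ℂ)
    (hre : ∀ j, (x j).re < 0) :
    ∃ C : ℝ, ∀ s : ℂ, 0 < s.re →
      (1 + ‖s‖) ^ Fintype.card ι ≤ C * ‖∏ j, (s - x j)‖ := by
  choose C hC using fun j => exists_one_add_norm_le_mul_norm_sub (hre j)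
  refine ⟨∏ j, C j, fun s hs => ?_⟩
  rw [norm_prod, ← Finset.prod_mul_distrib]
  calc (1 + ‖s‖) ^ Fintype.card ι = ∏ _j : ι, (1 + ‖s‖) := by simp
    _ ≤ ∏ j, C j * ‖s - x j‖ :=
      Finset.prod_le_prod (fun _ _ => by positivity) fun j _ => hC j s hs

theorem exists_norm_eval_le_mul_one_add_norm_pow {T : ℂ[X]} {m : ℕ} (hT : T.natDegree ≤ m) :
    ∃ K : ℝ, 0 ≤ K ∧ ∀ s : ℂ, ‖T.eval s‖ ≤ K * (1 + ‖s‖) ^ m := by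
  refine ⟨∑ i ∈ Finset.range (T.natDegree + 1), ‖T.coeff i‖, by positivity, fun s => ?_⟩
  rw [Polynomial.eval_eq_sum_range, Finset.sum_mul]
  refine norm_sum_le_of_le _ fun i hi => ?_
  rw [norm_mul, norm_pow]
  have hi' : i ≤ m := by
    have := Finset.mem_range.1 hi
    omega
  have hs : 0 ≤ ‖s‖ := norm_nonneg s
  gcongr
  calc ‖s‖ ^ i ≤ (1 + ‖s‖) ^ i := by gcongr; linarith
    _ ≤ (1 + ‖s‖) ^ m := pow_le_pow_right₀ (by linarith) hi'

/-- Small perturbations `u + a`, `u + b` of the same nonzero number have a quotient with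
nonnegative real part. -/
theorem re_add_div_add_nonneg {u a b : ℂ} (hu : u ≠ 0) (ha : 3 * ‖a‖ ≤ ‖u‖)
    (hb : 3 * ‖b‖ ≤ ‖u‖) : u + b ≠ 0 ∧ 0 ≤ ((u + a) / (u + b)).re := by
  have hu' : 0 < ‖u‖ := norm_pos_iff.2 hu
  have hlow : ‖u‖ - ‖b‖ ≤ ‖u + b‖ := by
    simpa using norm_sub_norm_le u (-b)
  have hpos : 0 < ‖u + b‖ := by linarith
  have hne : u + b ≠ 0 := norm_pos_iff.1 hpos
  refine ⟨hne, ?_⟩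
  have heq : (u + a) / (u + b) = 1 + (a - b) / (u + b) := by
    field_simp
    ring
  have hle : ‖(a - b) / (u + b)‖ ≤ 1 := by
    rw [norm_div, div_le_one hpos]
    linarith [norm_sub_le a b]
  have := (abs_le.1 ((Complex.abs_re_le_norm _).trans hle)).1
  rw [heq, Complex.add_re, Complex.one_re]
  linarith

theorem exists_real_prod_X_sub_C {ι : Type*} [Fintype ι] {x : ι → ℂ}
    (hx : Function.Injective x) {σ : ι → ι} (hσx : ∀ j, x (σ j) = starRingEnd ℂ (x j)) :
    ∃ p : ℝ[X], p.map (algebraMap ℝ ℂ) = ∏ j, (X - C (x j)) := by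
  have hσ : Function.Bijective σ := Finite.injective_iff_bijective.1 fun i j hij =>
    hx ((starRingEnd ℂ).injective (by rw [← hσx, ← hσx, hij]))
  apply exists_real_of_map_conj_eq
  rw [Polynomial.map_prod]
  simp only [Polynomial.map_sub, map_X, map_C, ← hσx]
  exact hσ.prod_comp fun j => X - C (x j)

theorem exists_real_interpolant {ι : Type*} [Fintype ι] {x y : ι → ℂ}
    (hx : Function.Injective x) {σ : ι → ι} (hσx : ∀ j, x (σ j) = starRingEnd ℂ (x j))
    (hσy : ∀ j, y (σ j) = starRingEnd ℂ (y j)) :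
    ∃ t : ℝ[X], t.degree < Fintype.card ι ∧ ∀ j, aeval (x j) t = y j := by
  classical
  have hinj : Set.InjOn x (Finset.univ : Finset ι) := hx.injOn
  have hdeg := Lagrange.degree_interpolate_lt y hinj
  have heval : ∀ j, (Lagrange.interpolate Finset.univ x y).eval (x j) = y j := fun j =>
    Lagrange.eval_interpolate_at_node y hinj (Finset.mem_univ j)
  obtain ⟨t, ht⟩ := exists_real_of_map_conj_eq
    (P := Lagrange.interpolate Finset.univ x y) <| by
      refine Lagrange.eq_interpolate_of_eval_eq y hinj ?_ fun j _ => ?_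
      · rwa [degree_map]
      · rw [← Complex.conj_conj (x j), ← hσx, eval_map_apply, heval, hσy, Complex.conj_conj]
  refine ⟨t, ?_, fun j => ?_⟩
  · rwa [← ht, degree_map] at hdeg
  · rw [aeval_def, ← eval_map, ht, heval]

/-- Any set of `m` distinct nodes in the open left half plane can be mapped to anywhere
in `ℂ` by a positive real rational function of degree at most `m`: if the data
`(x j, y j)` is closed under complex conjugation via `σ`, then there are real
polynomials `ν, d` of degree at most `m` such that `(ν, d)` is positive real, and
`d (x j) ≠ 0` with `ν (x j) / d (x j) = y j` for every `j`. -/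
theorem statement19 (m : ℕ) (hm : 1 ≤ m) (x y : Fin m → ℂ) (hx : Function.Injective x)
    (hre : ∀ j, (x j).re < 0)
    (σ : Fin m → Fin m)
    (hσx : ∀ j, x (σ j) = starRingEnd ℂ (x j))
    (hσy : ∀ j, y (σ j) = starRingEnd ℂ (y j)) :
    ∃ ν d : Polynomial ℝ,
      ν.degree ≤ (m : ℕ) ∧ d.degree ≤ (m : ℕ) ∧
      IsPosReal ν d ∧
      ∀ j, (Polynomial.aeval (x j)) d ≠ 0 ∧
        (Polynomial.aeval (x j)) ν / (Polynomial.aeval (x j)) d = y j := by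
  obtain ⟨p, hp⟩ := exists_real_prod_X_sub_C hx hσx
  obtain ⟨t, htdeg, ht⟩ := exists_real_interpolant hx hσx hσy
  rw [Fintype.card_fin] at htdeg
  have hpeval : ∀ s : ℂ, aeval s p = ∏ j, (s - x j) := fun s => by
    rw [aeval_def, ← eval_map, hp, eval_prod]
    simp
  have hpdeg : p.degree = m := by
    rw [← degree_map p (algebraMap ℝ ℂ), hp, degree_prod]
    simp
  have hpx : ∀ j, aeval (x j) p = 0 := fun j => by
    rw [hpeval]
    exact Finset.prod_eq_zero (Finset.mem_univ j) (sub_self _)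
  obtain ⟨B, hB⟩ := exists_one_add_norm_pow_le_mul_norm_prod x hre
  obtain ⟨K, hK, hKt⟩ := exists_norm_eval_le_mul_one_add_norm_pow
    (T := t.map (algebraMap ℝ ℂ)) (m := m)
    (by rw [natDegree_map]; exact natDegree_le_of_degree_le htdeg.le)
  have hppos : ∀ s : ℂ, 0 < s.re → 0 < ‖aeval s p‖ := fun s hs => by
    rw [hpeval, norm_pos_iff, Finset.prod_ne_zero_iff]
    intro j _ h
    have := hre j
    rw [← sub_eq_zero.1 h] at this
    linarith
  have hBpos : 0 < B := by
    have h := hB 1 (by simp)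
    rw [← hpeval] at h
    exact pos_of_mul_pos_left (lt_of_lt_of_le (by positivity) h) (norm_nonneg _)
  obtain ⟨ε, hε, hεB⟩ : ∃ ε : ℝ, 0 < ε ∧ 3 * ε * (K + 1) * B = 1 :=
    ⟨1 / (3 * (K + 1) * B), by positivity, by field_simp⟩
  have hsmall : ∀ s : ℂ, 0 < s.re → 3 * ε * ((K + 1) * (1 + ‖s‖) ^ m) ≤ ‖aeval s p‖ := by
    intro s hs
    have h := hB s hs
    rw [← hpeval, Fintype.card_fin] at h
    calc 3 * ε * ((K + 1) * (1 + ‖s‖) ^ m)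
        ≤ 3 * ε * ((K + 1) * (B * ‖aeval s p‖)) := by gcongr
      _ = 3 * ε * (K + 1) * B * ‖aeval s p‖ := by ring
      _ = ‖aeval s p‖ := by rw [hεB, one_mul]
  have hmain : ∀ s : ℂ, 0 < s.re → aeval s (p + C ε) ≠ 0 ∧
      0 ≤ (aeval s (p + C ε * t) / aeval s (p + C ε)).re := by
    intro s hs
    have hone : 1 ≤ (1 + ‖s‖) ^ m := one_le_pow₀ (by linarith [norm_nonneg s])
    have hst : ‖aeval s t‖ ≤ K * (1 + ‖s‖) ^ m := by
      have h := hKt s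
      rwa [eval_map, ← aeval_def] at h
    simp only [map_add, map_mul, aeval_C]
    refine re_add_div_add_nonneg (norm_pos_iff.1 (hppos s hs))
      (le_trans ?_ (hsmall s hs)) (le_trans ?_ (hsmall s hs))
    · rw [norm_mul, norm_algebraMap', Real.norm_of_nonneg hε.le, ← mul_assoc]
      gcongr
      linarith
    · rw [norm_algebraMap', Real.norm_of_nonneg hε.le]
      have : 1 ≤ (K + 1) * (1 + ‖s‖) ^ m := one_le_mul_of_one_le_of_one_le (by linarith) hone
      exact le_mul_of_one_le_right (by positivity) this
  have hεC : (algebraMap ℝ ℂ) ε ≠ 0 := by simpa using hε.ne'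
  refine ⟨p + C ε * t, p + C ε, ?_, ?_, ⟨?_, hmain⟩, fun j => ?_⟩
  · refine (degree_add_le _ _).trans (max_le hpdeg.le ?_)
    rw [degree_C_mul hε.ne']
    exact htdeg.le
  · exact (degree_add_le _ _).trans
      (max_le hpdeg.le (degree_C_le.trans (by exact_mod_cast Nat.zero_le m)))
  · intro h
    exact (hmain 1 (by simp)).1 (by rw [h, map_zero])
  · simp only [map_add, map_mul, aeval_C, hpx, ht, zero_add]
    exact ⟨hεC, mul_div_cancel_left₀ _ hεC⟩
end
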